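/- arXiv:2104.12718 — 2 statements merged into one kernel-verified Lean document; each statement's English description precedes it below -/
import Mathlib

section
/- For all sufficiently large n the following holds. Let G ∈ Φ(K_n^↔) with colouring φ, let m < n / log n, let T be a 256-regular 2RMBG(7m, 2m) with bipartition (A,B) and flexible sets A' ⊆ A, B' ⊆ B, let U ⊆ [n] and D ⊆ [n] with |U| = |D| = 7m, and let V' ⊆ U and C' ⊆ D with |V'| = |C'| = 2m. Suppose that for all v, c ∈ [n], G contains a well-spread collection of at least n²/2¹⁰⁰ (v,c)-absorbing gadgets, and that for all distinct y, z ∈ [n], G contains a well-spread collection of at least n²/10⁵⁰ (y,z)-bridging gadgets. Then G contains a T-absorber H whose set of root vertices is U and whose set of root colours is D, such that the root vertices corresponding to A' are exactly V' and the root colours corresponding to B' are exactly C' (i.e., the injections f_V, f_C of the T-absorber satisfy f_V(A) = U, f_C(B) = D, f_V(A') = V', f_C(B') = C'). -/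
open scoped Classical

noncomputable section

namespace RandomLatin

/-- `φ` is a proper `n`-arc-colouring of the complete digraph with loops on `Fin n`:
`φ i j` is the colour of the arc `i → j`, and no two arcs of the same colour share
a common tail or a common head. -/
def IsProper {n : ℕ} (φ : Fin n → Fin n → Fin n) : Prop :=
  (∀ i j j' : Fin n, φ i j = φ i j' → j = j') ∧
  (∀ i i' j : Fin n, φ i j = φ i' j → i = i')

/-- The set `Φ(K_n^↔)` of proper `n`-arc-colourings of the complete digraph with loops. -/
abbrev Colouring (n : ℕ) : Type := {φ : Fin n → Fin n → Fin n // IsProper φ}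

/-- `L` is an `n × n` Latin square with symbols `Fin n`. -/
def IsLatin {n : ℕ} (L : Fin n → Fin n → Fin n) : Prop :=
  (∀ i, Function.Bijective (L i)) ∧ (∀ j, Function.Bijective fun i => L i j)

abbrev LatinSquare (n : ℕ) : Type := {L : Fin n → Fin n → Fin n // IsLatin L}

/-- The set of positions `{(i, σ i) : i}` is a (full) transversal of `L`. -/
def IsTransversal {n : ℕ} (L : Fin n → Fin n → Fin n) (σ : Equiv.Perm (Fin n)) : Prop :=
  Function.Bijective fun i => L i (σ i)

/-- A transversal is Hamilton if its arc set `{i → σ i}` is a directed Hamilton cycle. -/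
def IsHamiltonTransversal {n : ℕ} (L : Fin n → Fin n → Fin n) (σ : Equiv.Perm (Fin n)) :
    Prop :=
  IsTransversal L σ ∧ σ.IsCycle ∧ σ.support = Finset.univ

def hamTransversalCount {n : ℕ} (L : Fin n → Fin n → Fin n) : ℕ :=
  Nat.card {σ : Equiv.Perm (Fin n) // IsHamiltonTransversal L σ}

/-- The number of rainbow directed Hamilton cycles of a coloured `K_n^↔`. -/
def rainbowHamCycleCount {n : ℕ} (φ : Fin n → Fin n → Fin n) : ℕ :=
  Nat.card {σ : Equiv.Perm (Fin n) //
    Function.Injective (fun i => φ i (σ i)) ∧ σ.IsCycle ∧ σ.support = Finset.univ}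

/-- The maximum number of appearances of a symbol on the leading diagonal. -/
def diagMax {n : ℕ} (L : Fin n → Fin n → Fin n) : ℕ :=
  Finset.univ.sup fun s : Fin n => (Finset.univ.filter fun i : Fin n => L i i = s).card

/-! ### The spaces `𝒢_D` -/

/-- `𝒢_D`: proper arc-colourings, with colour set `D`, of spanning subdigraphs of `K_n^↔`
in which every vertex has in- and out-degree `|D|`.  `f d i` is the head of the unique
`d`-coloured arc with tail `i`. -/
def GD (n : ℕ) (D : Finset (Fin n)) : Type :=
  {f : {d : Fin n // d ∈ D} → Fin n → Fin n //
    (∀ d, Function.Bijective (f d)) ∧ ∀ i : Fin n, Function.Injective fun d => f d i}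

/-- `comp H`: the number of completions of `H ∈ 𝒢_D` to an element of `Φ(K_n^↔)`,
i.e. the number of `g ∈ 𝒢_{Dᶜ}` whose arc set is disjoint from that of `H`. -/
def completionCount {n : ℕ} {D : Finset (Fin n)} (H : GD n D) : ℕ :=
  Nat.card {g : GD n Dᶜ //
    ∀ (d : {d : Fin n // d ∈ D}) (d' : {d : Fin n // d ∈ Dᶜ}) (i : Fin n),
      H.1 d i ≠ g.1 d' i}

/-- `e_H(A₁, A₂)`: the number of arcs of `H` with tail in `A₁` and head in `A₂`. -/
def eArcs {n : ℕ} {D : Finset (Fin n)} (H : GD n D) (A₁ A₂ : Finset (Fin n)) : ℕ :=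
  Nat.card {p : {d : Fin n // d ∈ D} × Fin n // p.2 ∈ A₁ ∧ H.1 p.1 p.2 ∈ A₂}

/-! ### Absorbing gadgets -/

/-- A `(v,c)`-absorbing gadget, recorded by its vertices `x 0 = x₁, …, x 5 = x₆`. -/
def IsAbsGadget {n : ℕ} (φ : Fin n → Fin n → Fin n) (v c : Fin n) (x : Fin 6 → Fin n) :
    Prop :=
  ([v, x 0, x 1, x 2, x 3, x 4, x 5] : List (Fin n)).Nodup ∧
  φ (x 0) v = φ (x 3) (x 5) ∧
  φ v (x 1) = φ (x 2) (x 4) ∧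
  φ (x 0) (x 1) = φ (x 2) (x 3) ∧
  φ (x 4) (x 5) = c ∧
  ([φ (x 0) v, φ v (x 1), φ (x 0) (x 1), c] : List (Fin n)).Nodup

def absGadgetVerts {n : ℕ} (v : Fin n) (x : Fin 6 → Fin n) : Finset (Fin n) :=
  insert v (Finset.image x Finset.univ)

/-- The gadget contains an arc of colour `d`. -/
def absGadgetHasColour {n : ℕ} (φ : Fin n → Fin n → Fin n) (v : Fin n)
    (x : Fin 6 → Fin n) (d : Fin n) : Prop :=
  d = φ (x 0) v ∨ d = φ v (x 1) ∨ d = φ (x 0) (x 1) ∨ d = φ (x 2) (x 3) ∨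
  d = φ (x 2) (x 4) ∨ d = φ (x 3) (x 5) ∨ d = φ (x 4) (x 5)

def WellSpreadAbsGadgets {n : ℕ} (φ : Fin n → Fin n → Fin n) (v c : Fin n)
    (𝒜 : Finset (Fin 6 → Fin n)) : Prop :=
  (∀ u : Fin n, u ≠ v → (𝒜.filter fun x => u ∈ absGadgetVerts v x).card ≤ n) ∧
  (∀ d : Fin n, d ≠ c → (𝒜.filter fun x => absGadgetHasColour φ v x d).card ≤ n)

/-! ### Bridging gadgets (with respect to a full colouring) -/

/-- A `(y,z)`-bridging gadget, recorded by its vertices `w 0 = w₁, …, w 5 = w₆`. -/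
def IsBridgeGadget {n : ℕ} (φ : Fin n → Fin n → Fin n) (y z : Fin n)
    (w : Fin 6 → Fin n) : Prop :=
  ([y, z, w 0, w 1, w 2, w 3, w 4, w 5] : List (Fin n)).Nodup ∧
  φ y (w 0) = φ (w 5) (w 4) ∧
  φ (w 1) (w 0) = φ (w 5) z ∧
  φ (w 3) y = φ (w 1) (w 2) ∧
  φ (w 3) (w 4) = φ z (w 2) ∧
  ([φ y (w 0), φ (w 1) (w 0), φ (w 3) y, φ (w 3) (w 4)] : List (Fin n)).Nodup

def bridgeVerts {n : ℕ} (y z : Fin n) (w : Fin 6 → Fin n) : Finset (Fin n) :=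
  insert y (insert z (Finset.image w Finset.univ))

def bridgeHasColour {n : ℕ} (φ : Fin n → Fin n → Fin n) (y z : Fin n)
    (w : Fin 6 → Fin n) (d : Fin n) : Prop :=
  d = φ y (w 0) ∨ d = φ (w 1) (w 0) ∨ d = φ (w 1) (w 2) ∨ d = φ z (w 2) ∨
  d = φ (w 3) y ∨ d = φ (w 3) (w 4) ∨ d = φ (w 5) (w 4) ∨ d = φ (w 5) z

def WellSpreadBridgeGadgets {n : ℕ} (φ : Fin n → Fin n → Fin n) (y z : Fin n)
    (ℬ : Finset (Fin 6 → Fin n)) : Prop :=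
  (∀ u : Fin n, u ≠ y → u ≠ z → (ℬ.filter fun w => u ∈ bridgeVerts y z w).card ≤ n) ∧
  (∀ d : Fin n, (ℬ.filter fun w => bridgeHasColour φ y z w d).card ≤ n)


/-- The number of loops of colour `c`. -/
def loopCount {n : ℕ} (φ : Fin n → Fin n → Fin n) (c : Fin n) : ℕ :=
  Nat.card {i : Fin n // φ i i = c}

/-- For all `v, c`, a well-spread collection of at least `n²/2¹⁰⁰` `(v,c)`-absorbing
gadgets exists. -/
def HasAbsGadgets {n : ℕ} (φ : Fin n → Fin n → Fin n) : Prop :=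
  ∀ v c : Fin n, ∃ 𝒜 : Finset (Fin 6 → Fin n),
    (∀ x ∈ 𝒜, IsAbsGadget φ v c x) ∧ WellSpreadAbsGadgets φ v c 𝒜 ∧
    (n : ℝ) ^ 2 / 2 ^ 100 ≤ 𝒜.card

/-- For all distinct `y, z`, a well-spread collection of at least `n²/10⁵⁰`
`(y,z)`-bridging gadgets exists. -/
def HasBridgeGadgets {n : ℕ} (φ : Fin n → Fin n → Fin n) : Prop :=
  ∀ y z : Fin n, y ≠ z → ∃ ℬ : Finset (Fin 6 → Fin n),
    (∀ w ∈ ℬ, IsBridgeGadget φ y z w) ∧ WellSpreadBridgeGadgets φ y z ℬ ∧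
    (n : ℝ) ^ 2 / 10 ^ 50 ≤ ℬ.card

/-! ### `(y,z,𝒫)`-bridges in `𝒢_D` -/

/-- `(D₁, …, D₆)` is an equitable ordered partition of `D` into six parts. -/
def IsEquitableSixPartition {n : ℕ} (D : Finset (Fin n)) (P : Fin 6 → Finset (Fin n)) :
    Prop :=
  (∀ i, P i ⊆ D) ∧ (∀ i j, i ≠ j → Disjoint (P i) (P j)) ∧
  (Finset.univ.biUnion P = D) ∧ (∀ i j, (P i).card ≤ (P j).card + 1)

/-- A `(y,z,𝒫)`-bridge in `H ∈ 𝒢_D`. -/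
def IsBridge {n : ℕ} {D : Finset (Fin n)} (H : GD n D) (y z : Fin n)
    (P : Fin 6 → Finset (Fin n)) (w : Fin 6 → Fin n) : Prop :=
  ([y, z, w 0, w 1, w 2, w 3, w 4, w 5] : List (Fin n)).Nodup ∧
  ∃ d₁ d₂ d₃ d₄ d₅ d₆ : {d : Fin n // d ∈ D},
    (d₁ : Fin n) ∈ P 0 ∧ (d₂ : Fin n) ∈ P 1 ∧ (d₃ : Fin n) ∈ P 2 ∧
    (d₄ : Fin n) ∈ P 3 ∧ (d₅ : Fin n) ∈ P 4 ∧ (d₆ : Fin n) ∈ P 5 ∧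
    H.1 d₁ y = w 0 ∧ H.1 d₁ (w 5) = w 4 ∧
    H.1 d₂ (w 1) = w 0 ∧ H.1 d₂ (w 5) = z ∧
    H.1 d₃ (w 3) = y ∧ H.1 d₃ (w 1) = w 2 ∧
    H.1 d₄ (w 3) = w 4 ∧ H.1 d₄ z = w 2 ∧
    H.1 d₅ y = w 1 ∧ H.1 d₆ z = w 4

/-- The ten arcs of a `(y,z,𝒫)`-bridge. -/
def bridgeArcsOf {n : ℕ} (y z : Fin n) (w : Fin 6 → Fin n) : Finset (Fin n × Fin n) :=
  {(y, w 0), (w 1, w 0), (w 1, w 2), (z, w 2), (w 3, y), (w 3, w 4), (w 5, w 4), (w 5, z),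
   (y, w 1), (z, w 4)}

/-- The four arcs `w₂→w₁, w₂→w₃, w₄→w₅, w₆→w₅` of a bridge. -/
def keyArcsOf {n : ℕ} (w : Fin 6 → Fin n) : Finset (Fin n × Fin n) :=
  {(w 1, w 0), (w 1, w 2), (w 3, w 4), (w 5, w 4)}

/-- A distinguishable `(y,z,𝒫)`-bridge: the only bridge containing any of its four key arcs. -/
def IsDistinguishableBridge {n : ℕ} {D : Finset (Fin n)} (H : GD n D) (y z : Fin n)
    (P : Fin 6 → Finset (Fin n)) (w : Fin 6 → Fin n) : Prop :=
  IsBridge H y z P w ∧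
  ∀ w' : Fin 6 → Fin n, IsBridge H y z P w' →
    ¬ Disjoint (keyArcsOf w) (bridgeArcsOf y z w') → w' = w

/-- `r_{(y,z,𝒫)}(H)`: the number of distinguishable `(y,z,𝒫)`-bridges in `H`. -/
def distBridgeCount {n : ℕ} {D : Finset (Fin n)} (H : GD n D) (y z : Fin n)
    (P : Fin 6 → Finset (Fin n)) : ℕ :=
  Nat.card {w : Fin 6 → Fin n // IsDistinguishableBridge H y z P w}

/-- Membership in `Q̂_D^{(y,z,𝒫)} = ⋃_{s=0}^{n|D|} M_s^{(y,z,𝒫)}`. -/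
def InQhat {n : ℕ} {D : Finset (Fin n)} (H : GD n D) (y z : Fin n)
    (P : Fin 6 → Finset (Fin n)) : Prop :=
  distBridgeCount H y z P ≤ n * D.card ∧
  ∀ A₁ A₂ : Finset (Fin n), A₁.card = D.card → A₂.card = D.card →
    (eArcs H A₁ A₂ : ℝ) ≤ 2 * (D.card : ℝ) ^ 3 / n + 12 * distBridgeCount H y z P

/-- A `(y,z)`-bridging gadget of `H ∈ 𝒢_D`. -/
def IsBridgeGadgetGD {n : ℕ} {D : Finset (Fin n)} (H : GD n D) (y z : Fin n)
    (w : Fin 6 → Fin n) : Prop :=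
  ([y, z, w 0, w 1, w 2, w 3, w 4, w 5] : List (Fin n)).Nodup ∧
  ∃ d₁ d₂ d₃ d₄ : {d : Fin n // d ∈ D},
    ([(d₁ : Fin n), (d₂ : Fin n), (d₃ : Fin n), (d₄ : Fin n)] : List (Fin n)).Nodup ∧
    H.1 d₁ y = w 0 ∧ H.1 d₁ (w 5) = w 4 ∧
    H.1 d₂ (w 1) = w 0 ∧ H.1 d₂ (w 5) = z ∧
    H.1 d₃ (w 3) = y ∧ H.1 d₃ (w 1) = w 2 ∧
    H.1 d₄ (w 3) = w 4 ∧ H.1 d₄ z = w 2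

/-- The gadget (in `H ∈ 𝒢_D`) contains an arc of colour `d`. -/
def bridgeGadgetGDHasColour {n : ℕ} {D : Finset (Fin n)} (H : GD n D) (y z : Fin n)
    (w : Fin 6 → Fin n) (d : Fin n) : Prop :=
  ∃ d' : {d : Fin n // d ∈ D}, (d' : Fin n) = d ∧
    (H.1 d' y = w 0 ∨ H.1 d' (w 1) = w 0 ∨ H.1 d' (w 1) = w 2 ∨ H.1 d' z = w 2 ∨
     H.1 d' (w 3) = y ∨ H.1 d' (w 3) = w 4 ∨ H.1 d' (w 5) = w 4 ∨ H.1 d' (w 5) = z)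

def WellSpreadBridgeGadgetsGD {n : ℕ} {D : Finset (Fin n)} (H : GD n D) (y z : Fin n)
    (ℬ : Finset (Fin 6 → Fin n)) : Prop :=
  (∀ u : Fin n, u ≠ y → u ≠ z → (ℬ.filter fun w => u ∈ bridgeVerts y z w).card ≤ n) ∧
  (∀ d : Fin n, (ℬ.filter fun w => bridgeGadgetGDHasColour H y z w d).card ≤ n)

/-! ### Directed paths, absorbers, `T`-absorbers -/

/-- The arcs of the directed path whose vertices are the entries of `p`, in order. -/
def pathArcs {n : ℕ} (p : List (Fin n)) : List (Fin n × Fin n) := p.zip p.tail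

def pathColours {n : ℕ} (φ : Fin n → Fin n → Fin n) (p : List (Fin n)) : List (Fin n) :=
  (pathArcs p).map fun e => φ e.1 e.2

def internalVerts {n : ℕ} (p : List (Fin n)) : List (Fin n) := (p.drop 1).dropLast

set_option maxHeartbeats 1600000 in
/-- A `(v,c)`-absorber: a `(v,c)`-absorbing gadget with vertices `x`, bridged by an
`(x₄,x₅)`-bridging gadget with vertices `w`, completed by four rainbow directed paths. -/
structure Absorber (n : ℕ) (φ : Fin n → Fin n → Fin n) (v c : Fin n) where
  x : Fin 6 → Fin n
  w : Fin 6 → Fin n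
  P : Fin 4 → List (Fin n)
  gadget : IsAbsGadget φ v c x
  bridge : IsBridgeGadget φ (x 3) (x 4) w
  meetAB : absGadgetVerts v x ∩ bridgeVerts (x 3) (x 4) w = {x 3, x 4}
  colourDisjointAB :
    ∀ d : Fin n, absGadgetHasColour φ v x d → bridgeHasColour φ (x 3) (x 4) w d → False
  pathNodup : ∀ i, (P i).Nodup
  pathEnds :
    (P 0).head? = some (x 1) ∧ (P 0).getLast? = some (x 2) ∧
    (P 1).head? = some (w 0) ∧ (P 1).getLast? = some (w 3) ∧
    (P 2).head? = some (w 4) ∧ (P 2).getLast? = some (w 1) ∧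
    (P 3).head? = some (w 2) ∧ (P 3).getLast? = some (w 5)
  pathsDisjoint : ∀ i j, i ≠ j → ∀ a ∈ P i, a ∉ P j
  pathInternalDisjoint : ∀ i, ∀ a ∈ internalVerts (P i),
    a ∉ absGadgetVerts v x ∧ a ∉ bridgeVerts (x 3) (x 4) w
  pathsRainbowEach : ∀ i, (pathColours φ (P i)).Nodup
  pathsRainbowPair : ∀ i j, i ≠ j → ∀ d ∈ pathColours φ (P i), d ∉ pathColours φ (P j)
  pathColoursNew : ∀ i, ∀ d ∈ pathColours φ (P i),
    ¬ absGadgetHasColour φ v x d ∧ ¬ bridgeHasColour φ (x 3) (x 4) w d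

def Absorber.arcs {n : ℕ} {φ : Fin n → Fin n → Fin n} {v c : Fin n}
    (A : Absorber n φ v c) : Finset (Fin n × Fin n) :=
  ({(A.x 0, v), (v, A.x 1), (A.x 0, A.x 1), (A.x 2, A.x 3), (A.x 2, A.x 4),
    (A.x 3, A.x 5), (A.x 4, A.x 5)} : Finset (Fin n × Fin n)) ∪
  ({(A.x 3, A.w 0), (A.w 1, A.w 0), (A.w 1, A.w 2), (A.x 4, A.w 2), (A.w 3, A.x 3),
    (A.w 3, A.w 4), (A.w 5, A.w 4), (A.w 5, A.x 4)} : Finset (Fin n × Fin n)) ∪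
  Finset.univ.biUnion fun i : Fin 4 => (pathArcs (A.P i)).toFinset

def Absorber.verts {n : ℕ} {φ : Fin n → Fin n → Fin n} {v c : Fin n}
    (A : Absorber n φ v c) : Finset (Fin n) :=
  absGadgetVerts v A.x ∪ bridgeVerts (A.x 3) (A.x 4) A.w ∪
    Finset.univ.biUnion fun i : Fin 4 => (A.P i).toFinset

def Absorber.colours {n : ℕ} {φ : Fin n → Fin n → Fin n} {v c : Fin n}
    (A : Absorber n φ v c) : Finset (Fin n) :=
  A.arcs.image fun e => φ e.1 e.2

def Absorber.initial {n : ℕ} {φ : Fin n → Fin n → Fin n} {v c : Fin n}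
    (A : Absorber n φ v c) : Fin n := A.x 0

def Absorber.terminal {n : ℕ} {φ : Fin n → Fin n → Fin n} {v c : Fin n}
    (A : Absorber n φ v c) : Fin n := A.x 5

/-- A `T`-absorber inside the coloured `K_n^↔`, with arc set `H`. -/
structure TAbsorber (n : ℕ) (φ : Fin n → Fin n → Fin n) {α β : Type}
    [Fintype α] [Fintype β] [DecidableEq α] [DecidableEq β]
    (T : Finset (α × β)) (H : Finset (Fin n × Fin n)) where
  fV : α → Fin n
  fC : β → Fin n
  fVinj : Function.Injective fV
  fCinj : Function.Injective fC
  fCrange : ∀ b : β, fC b ∈ H.image fun e : Fin n × Fin n => φ e.1 e.2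
  Ab : (e : α × β) → e ∈ T → Absorber n φ (fV e.1) (fC e.2)
  AbSub : ∀ e he, (Ab e he).arcs ⊆ H
  AbUnique : ∀ e he (A' : Absorber n φ (fV e.1) (fC e.2)),
    A'.arcs ⊆ H → A'.arcs = (Ab e he).arcs
  AbVertexDisjoint : ∀ e he e' he', e ≠ e' →
    ∀ u : Fin n, u ∈ (Ab e he).verts → u ∈ (Ab e' he').verts → e.1 = e'.1 ∧ u = fV e.1
  AbColourDisjoint : ∀ e he e' he', e ≠ e' →
    ∀ d : Fin n, d ∈ (Ab e he).colours → d ∈ (Ab e' he').colours → e.2 = e'.2 ∧ d = fC e.2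
  es : Fin T.card → α × β
  esInj : Function.Injective es
  esMem : ∀ i, es i ∈ T
  link : Fin (T.card - 1) → List (Fin n)
  linkLen : ∀ i, (link i).length = 4
  linkNodup : ∀ i, (link i).Nodup
  linkSub : ∀ i, ∀ e ∈ pathArcs (link i), e ∈ H
  linkPairwiseDisjoint : ∀ i j, i ≠ j → ∀ a ∈ link i, a ∉ link j
  linkRainbowEach : ∀ i, (pathColours φ (link i)).Nodup
  linkRainbowPair : ∀ i j, i ≠ j → ∀ d ∈ pathColours φ (link i), d ∉ pathColours φ (link j)
  linkColourNew : ∀ i, ∀ d ∈ pathColours φ (link i), ∀ e he, d ∉ (Ab e he).colours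
  linkHead : ∀ i : Fin (T.card - 1),
    (link i).head? = some (Ab (es (Fin.castLE (Nat.sub_le _ _) i)) (esMem _)).terminal
  linkLast : ∀ i : Fin (T.card - 1),
    (link i).getLast? =
      some (Ab (es ⟨i.1 + 1, by have := i.2; omega⟩) (esMem _)).initial
  linkInternalDisjoint : ∀ i, ∀ a ∈ internalVerts (link i), ∀ e he, a ∉ (Ab e he).verts
  minimal : H = (T.attach.biUnion fun e => (Ab e.1 e.2).arcs) ∪
      (Finset.univ.biUnion fun i => (pathArcs (link i)).toFinset)

def TAbsorber.initialVtx {n : ℕ} {φ : Fin n → Fin n → Fin n} {α β : Type}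
    [Fintype α] [Fintype β] [DecidableEq α] [DecidableEq β]
    {T : Finset (α × β)} {H : Finset (Fin n × Fin n)} (𝔸 : TAbsorber n φ T H)
    (h : 0 < T.card) : Fin n :=
  (𝔸.Ab (𝔸.es ⟨0, h⟩) (𝔸.esMem _)).initial

def TAbsorber.terminalVtx {n : ℕ} {φ : Fin n → Fin n → Fin n} {α β : Type}
    [Fintype α] [Fintype β] [DecidableEq α] [DecidableEq β]
    {T : Finset (α × β)} {H : Finset (Fin n × Fin n)} (𝔸 : TAbsorber n φ T H)
    (h : 0 < T.card) : Fin n :=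
  (𝔸.Ab (𝔸.es ⟨T.card - 1, Nat.sub_lt h Nat.one_pos⟩) (𝔸.esMem _)).terminal

/-- `T` (bipartite, edge set a finset of `α × β`) is robustly matchable with respect to
flexible sets `A'`, `B'`. -/
def RobustlyMatchable {α β : Type} [DecidableEq α] [DecidableEq β]
    (T : Finset (α × β)) (A' : Finset α) (B' : Finset β) : Prop :=
  ∀ X : Finset α, ∀ Y : Finset β, X ⊆ A' → Y ⊆ B' → X.card = Y.card →
    (X.card : ℝ) ≤ min ((A'.card : ℝ) / 2) ((B'.card : ℝ) / 2) →
    ∃ M : Finset (α × β), M ⊆ T ∧ (∀ e ∈ M, e.1 ∉ X ∧ e.2 ∉ Y) ∧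
      (∀ a : α, a ∉ X → ∃! e, e ∈ M ∧ e.1 = a) ∧
      (∀ b : β, b ∉ Y → ∃! e, e ∈ M ∧ e.2 = b)

def arcVerts {n : ℕ} (H : Finset (Fin n × Fin n)) : Finset (Fin n) :=
  H.image Prod.fst ∪ H.image Prod.snd

/-- `H` (an arc set in the coloured `K_n^↔`) is robustly rainbow-Hamiltonian with respect
to flexible sets `Vf`, `Cf` and initial and terminal vertices `u`, `v`. -/
def RobustlyRainbowHam {n : ℕ} (φ : Fin n → Fin n → Fin n) (H : Finset (Fin n × Fin n))
    (Vf Cf : Finset (Fin n)) (u v : Fin n) : Prop :=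
  ∀ X Y : Finset (Fin n), X ⊆ Vf → Y ⊆ Cf → X.card = Y.card →
    (X.card : ℝ) ≤ min ((Vf.card : ℝ) / 2) ((Cf.card : ℝ) / 2) →
    ∃ p : List (Fin n), p.Nodup ∧ p.head? = some u ∧ p.getLast? = some v ∧
      (∀ e ∈ pathArcs p, e ∈ H) ∧
      (∀ a ∈ p, a ∉ X) ∧
      p.toFinset = arcVerts H \ X ∧
      (pathColours φ p).Nodup ∧
      (∀ d ∈ pathColours φ p, d ∉ Y)

/-! ### Lower-quasirandomness and rainbow directed path forests -/

/-- `e_{G,D}(U₁,U₂)`: the number of arcs with tail in `U₁`, head in `U₂`, colour in `D`. -/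
def colArcCount {n : ℕ} (φ : Fin n → Fin n → Fin n) (U₁ U₂ D : Finset (Fin n)) : ℕ :=
  Nat.card {p : Fin n × Fin n // p.1 ∈ U₁ ∧ p.2 ∈ U₂ ∧ φ p.1 p.2 ∈ D}

def LowerQuasirandom {n : ℕ} (φ : Fin n → Fin n → Fin n) : Prop :=
  ∀ U₁ U₂ D : Finset (Fin n),
    (U₁.card : ℝ) * U₂.card * D.card / n - (n : ℝ) ^ (5 / 3 : ℝ) ≤ colArcCount φ U₁ U₂ D

/-- The arc set `Q` contains a directed cycle (a loop counts as a cycle of length one). -/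
def HasDiCycle {n : ℕ} (Q : Finset (Fin n × Fin n)) : Prop :=
  ∃ (a : Fin n) (l : List (Fin n)), (a :: l).Nodup ∧
    List.Chain (fun u v : Fin n => (u, v) ∈ Q) a l ∧
    ((a :: l).getLast (List.cons_ne_nil a l), a) ∈ Q

/-- `Q` is (the arc set of) a spanning rainbow directed path forest of `G − U`, using no
colour of `D`, with at most `n^{9/10}` components. -/
def IsGoodPathForest {n : ℕ} (φ : Fin n → Fin n → Fin n) (U D : Finset (Fin n))
    (Q : Finset (Fin n × Fin n)) : Prop :=
  (∀ e ∈ Q, e.1 ∉ U ∧ e.2 ∉ U) ∧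
  (∀ e ∈ Q, ∀ e' ∈ Q, e ≠ e' → e.1 ≠ e'.1 ∧ e.2 ≠ e'.2) ∧
  ¬ HasDiCycle Q ∧
  Set.InjOn (fun e : Fin n × Fin n => φ e.1 e.2) (Q : Set (Fin n × Fin n)) ∧
  (∀ e ∈ Q, φ e.1 e.2 ∉ D) ∧
  ((n : ℝ) - U.card - Q.card ≤ (n : ℝ) ^ (9 / 10 : ℝ))


/-- The arcs of an absorber whose completing paths all have length three, together with their
colours. Vertex `0` is the root, `1, …, 6` the absorbing gadget, `7, …, 12` the bridging gadget and
`13, …, 20` the interiors of the paths; colour `0` is the root colour. -/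
def absorberTemplate : List (Fin 21 × Fin 21 × Fin 20) :=
  [(1, 0, 1), (0, 2, 2), (1, 2, 3), (3, 4, 3), (3, 5, 2), (4, 6, 1), (5, 6, 0),
   (4, 7, 4), (8, 7, 5), (8, 9, 6), (5, 9, 7), (10, 4, 6), (10, 11, 7), (12, 11, 4), (12, 5, 5),
   (2, 13, 8), (13, 14, 9), (14, 3, 10), (7, 15, 11), (15, 16, 12), (16, 10, 13),
   (11, 17, 14), (17, 18, 15), (18, 8, 16), (9, 19, 17), (19, 20, 18), (20, 12, 19)]

/-- A copy of `absorberTemplate` in the coloured digraph. -/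
structure AbsorberCopy {n : ℕ} (φ : Fin n → Fin n → Fin n) where
  g : Fin 21 → Fin n
  k : Fin 20 → Fin n
  g_inj : Function.Injective g
  k_inj : Function.Injective k
  colour_eq : ∀ t ∈ absorberTemplate, φ (g t.1) (g t.2.1) = k t.2.2

namespace AbsorberCopy

variable {n : ℕ} {φ : Fin n → Fin n → Fin n} (E : AbsorberCopy φ)

lemma colours_eq :
    (φ (E.g 1) (E.g 0) = E.k 1 ∧ φ (E.g 0) (E.g 2) = E.k 2 ∧ φ (E.g 1) (E.g 2) = E.k 3 ∧
      φ (E.g 3) (E.g 4) = E.k 3 ∧ φ (E.g 3) (E.g 5) = E.k 2 ∧ φ (E.g 4) (E.g 6) = E.k 1 ∧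
      φ (E.g 5) (E.g 6) = E.k 0) ∧
    (φ (E.g 4) (E.g 7) = E.k 4 ∧ φ (E.g 8) (E.g 7) = E.k 5 ∧ φ (E.g 8) (E.g 9) = E.k 6 ∧
      φ (E.g 5) (E.g 9) = E.k 7 ∧ φ (E.g 10) (E.g 4) = E.k 6 ∧ φ (E.g 10) (E.g 11) = E.k 7 ∧
      φ (E.g 12) (E.g 11) = E.k 4 ∧ φ (E.g 12) (E.g 5) = E.k 5) ∧
    (φ (E.g 2) (E.g 13) = E.k 8 ∧ φ (E.g 13) (E.g 14) = E.k 9 ∧ φ (E.g 14) (E.g 3) = E.k 10 ∧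
      φ (E.g 7) (E.g 15) = E.k 11 ∧ φ (E.g 15) (E.g 16) = E.k 12 ∧
      φ (E.g 16) (E.g 10) = E.k 13 ∧ φ (E.g 11) (E.g 17) = E.k 14 ∧
      φ (E.g 17) (E.g 18) = E.k 15 ∧ φ (E.g 18) (E.g 8) = E.k 16 ∧
      φ (E.g 9) (E.g 19) = E.k 17 ∧ φ (E.g 19) (E.g 20) = E.k 18 ∧
      φ (E.g 20) (E.g 12) = E.k 19) := by
  have h := E.colour_eq
  simpa [absorberTemplate, and_assoc] using h

/-- The positions of the vertices of the absorbing gadget in `absorberTemplate`. -/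
def gadgetIdx : Fin 6 → Fin 21 := ![1, 2, 3, 4, 5, 6]

/-- The positions of the vertices of the bridging gadget in `absorberTemplate`. -/
def bridgeIdx : Fin 6 → Fin 21 := ![7, 8, 9, 10, 11, 12]

/-- The positions of the vertices of the completing paths in `absorberTemplate`. -/
def pathIdx : Fin 4 → List (Fin 21) :=
  ![[2, 13, 14, 3], [7, 15, 16, 10], [11, 17, 18, 8], [9, 19, 20, 12]]

/-- The positions of the colours of the completing paths in `absorberTemplate`. -/
def pathColourIdx : Fin 4 → List (Fin 20) :=
  ![[8, 9, 10], [11, 12, 13], [14, 15, 16], [17, 18, 19]]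

lemma absGadgetVerts_eq :
    absGadgetVerts (E.g 0) (E.g ∘ gadgetIdx) = Finset.image E.g {0, 1, 2, 3, 4, 5, 6} := by
  rw [absGadgetVerts, ← Finset.image_image, ← Finset.image_insert]
  rfl

lemma bridgeVerts_eq :
    bridgeVerts (E.g 4) (E.g 5) (E.g ∘ bridgeIdx) =
      Finset.image E.g {4, 5, 7, 8, 9, 10, 11, 12} := by
  rw [bridgeVerts, ← Finset.image_image, ← Finset.image_insert, ← Finset.image_insert]
  rfl

lemma absGadgetHasColour_iff (d : Fin n) :
    absGadgetHasColour φ (E.g 0) (E.g ∘ gadgetIdx) d ↔ d ∈ Finset.image E.k {0, 1, 2, 3} := by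
  obtain ⟨⟨h1, h2, h3, h4, h5, h6, h7⟩, -⟩ := E.colours_eq
  simp [absGadgetHasColour, gadgetIdx, h1, h2, h3, h4, h5, h6, h7]
  grind

lemma bridgeHasColour_iff (d : Fin n) :
    bridgeHasColour φ (E.g 4) (E.g 5) (E.g ∘ bridgeIdx) d ↔
      d ∈ Finset.image E.k {4, 5, 6, 7} := by
  obtain ⟨-, ⟨h1, h2, h3, h4, h5, h6, h7, h8⟩, -⟩ := E.colours_eq
  simp [bridgeHasColour, bridgeIdx, h1, h2, h3, h4, h5, h6, h7, h8]
  grind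

lemma pathColours_eq (i : Fin 4) :
    pathColours φ ((pathIdx i).map E.g) = (pathColourIdx i).map E.k := by
  obtain ⟨-, -, h⟩ := E.colours_eq
  fin_cases i <;> simp [pathColours, pathArcs, pathIdx, pathColourIdx, h]

lemma isAbsGadget : IsAbsGadget φ (E.g 0) (E.k 0) (E.g ∘ gadgetIdx) := by
  obtain ⟨h, -⟩ := E.colours_eq
  simp [IsAbsGadget, gadgetIdx, h, E.g_inj.eq_iff, E.k_inj.eq_iff]

lemma isBridgeGadget : IsBridgeGadget φ (E.g 4) (E.g 5) (E.g ∘ bridgeIdx) := by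
  obtain ⟨-, h, -⟩ := E.colours_eq
  simp [IsBridgeGadget, bridgeIdx, h, E.g_inj.eq_iff, E.k_inj.eq_iff]

/-- The absorber given by a copy of the template. -/
def toAbsorber {v c : Fin n} (hv : E.g 0 = v) (hc : E.k 0 = c) : Absorber n φ v c where
  x := E.g ∘ gadgetIdx
  w := E.g ∘ bridgeIdx
  P i := (pathIdx i).map E.g
  gadget := by subst hv hc; exact E.isAbsGadget
  bridge := E.isBridgeGadget
  meetAB := by
    subst hv
    have h := E.bridgeVerts_eq
    change _ ∩ bridgeVerts (E.g 4) (E.g 5) _ = {E.g 4, E.g 5}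
    rw [h, absGadgetVerts_eq, ← Finset.image_inter _ _ E.g_inj,
      show ({E.g 4, E.g 5} : Finset (Fin n)) = Finset.image E.g {4, 5} by simp]
    rfl
  colourDisjointAB := by
    subst hv
    intro d hd hd'
    rw [absGadgetHasColour_iff] at hd
    replace hd' := (E.bridgeHasColour_iff d).1 hd'
    exact Finset.disjoint_left.1 ((Finset.disjoint_image E.k_inj).2 (by decide)) hd hd'
  pathNodup i := (by revert i; decide : ∀ i, (pathIdx i).Nodup) i |>.map E.g_inj
  pathEnds := by simp [pathIdx, gadgetIdx, bridgeIdx]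
  pathsDisjoint i j hij a ha hb := by
    obtain ⟨s, hs, rfl⟩ := List.mem_map.1 ha
    rw [List.mem_map_of_injective E.g_inj] at hb
    clear ha
    revert i j s
    decide
  pathInternalDisjoint i a ha := by
    subst hv
    have h := E.bridgeVerts_eq
    change _ ∧ a ∉ bridgeVerts (E.g 4) (E.g 5) _
    rw [h, absGadgetVerts_eq]
    have ha' : a ∈ (((pathIdx i).drop 1).dropLast).map E.g := by
      rwa [internalVerts, ← List.map_drop, ← List.map_dropLast] at ha
    obtain ⟨s, hs, rfl⟩ := List.mem_map.1 ha'
    rw [E.g_inj.mem_finset_image, E.g_inj.mem_finset_image]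
    clear ha ha' h
    revert i s
    decide
  pathsRainbowEach i := by
    rw [pathColours_eq]
    exact (by revert i; decide : ∀ i, (pathColourIdx i).Nodup) i |>.map E.k_inj
  pathsRainbowPair i j hij d hd hd' := by
    rw [pathColours_eq] at hd hd'
    obtain ⟨s, hs, rfl⟩ := List.mem_map.1 hd
    rw [List.mem_map_of_injective E.k_inj] at hd'
    clear hd
    revert i j s
    decide
  pathColoursNew i d hd := by
    subst hv
    have h := E.bridgeHasColour_iff d
    change _ ∧ ¬ bridgeHasColour φ (E.g 4) (E.g 5) _ d
    rw [h, absGadgetHasColour_iff]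
    rw [pathColours_eq] at hd
    obtain ⟨s, hs, rfl⟩ := List.mem_map.1 hd
    rw [E.k_inj.mem_finset_image, E.k_inj.mem_finset_image]
    clear hd h
    revert i s
    decide

lemma mem_arcs_toAbsorber {v c : Fin n} (hv : E.g 0 = v) (hc : E.k 0 = c) (e : Fin n × Fin n) :
    e ∈ (E.toAbsorber hv hc).arcs ↔ ∃ t ∈ absorberTemplate, e = (E.g t.1, E.g t.2.1) := by
  subst hv
  have h : (E.toAbsorber rfl hc).arcs =
      (absorberTemplate.map fun t => (E.g t.1, E.g t.2.1)).toFinset := by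
    ext e
    simp [Absorber.arcs, toAbsorber, absorberTemplate, gadgetIdx, bridgeIdx, pathIdx, pathArcs,
      Fin.exists_fin_succ]
    grind
  rw [h]
  simp only [List.mem_toFinset, List.mem_map, eq_comm]

lemma mem_verts_toAbsorber {v c : Fin n} (hv : E.g 0 = v) (hc : E.k 0 = c) (u : Fin n) :
    u ∈ (E.toAbsorber hv hc).verts ↔ ∃ s, u = E.g s := by
  subst hv
  have hb := E.bridgeVerts_eq
  have ha := E.absGadgetVerts_eq
  have h : (E.toAbsorber rfl hc).verts = Finset.image E.g Finset.univ := by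
    change _ ∪ bridgeVerts (E.g 4) (E.g 5) (E.g ∘ bridgeIdx) ∪ _ = _
    rw [hb]
    change absGadgetVerts (E.g 0) (E.g ∘ gadgetIdx) ∪ _ ∪ _ = _
    rw [ha]
    have hp : (Finset.univ.biUnion fun i : Fin 4 => ((E.toAbsorber rfl hc).P i).toFinset) =
        Finset.image E.g (Finset.univ.biUnion fun i : Fin 4 => (pathIdx i).toFinset) := by
      ext a
      simp [toAbsorber]
      grind
    rw [hp, ← Finset.image_union, ← Finset.image_union]
    congr 1
    decide
  rw [h]
  simp [eq_comm]

lemma mem_colours_toAbsorber {v c : Fin n} (hv : E.g 0 = v) (hc : E.k 0 = c) (d : Fin n) :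
    d ∈ (E.toAbsorber hv hc).colours ↔ ∃ s, d = E.k s := by
  simp only [Absorber.colours, Finset.mem_image, mem_arcs_toAbsorber]
  constructor
  · rintro ⟨e, ⟨t, ht, rfl⟩, rfl⟩
    exact ⟨_, E.colour_eq t ht⟩
  · rintro ⟨s, rfl⟩
    obtain ⟨t, ht, rfl⟩ : ∃ t ∈ absorberTemplate, t.2.2 = s := by revert s; decide
    exact ⟨_, ⟨t, ht, rfl⟩, E.colour_eq t ht⟩

end AbsorberCopy

/-- A rigid path: if each of `a`, `b`, `c` has a unique out-arc in `S` along `a → b → c → d`, then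
a duplicate-free directed walk in `S` from `a` to `d` is exactly this path. -/
lemma path_eq_of_unique_out {n : ℕ} {S : Finset (Fin n × Fin n)} {a b c d : Fin n}
    (had : a ≠ d) (hbd : b ≠ d) (hcd : c ≠ d)
    (ha : ∀ q, (a, q) ∈ S → q = b) (hb : ∀ q, (b, q) ∈ S → q = c) (hc : ∀ q, (c, q) ∈ S → q = d)
    {p : List (Fin n)} (hp : p.Nodup) (hhead : p.head? = some a) (hlast : p.getLast? = some d)
    (hS : ∀ e ∈ pathArcs p, e ∈ S) : p = [a, b, c, d] := by
  match p, hhead with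
  | [a'], hh => simp_all
  | [a', b'], hh =>
    simp [pathArcs] at hh hS hlast
    subst hh hlast
    exact absurd (ha _ hS) (Ne.symm hbd)
  | [a', b', c'], hh =>
    simp [pathArcs] at hh hS hlast
    subst hh hlast
    obtain rfl := ha _ hS.1
    exact absurd (hb _ hS.2) (Ne.symm hcd)
  | a' :: b' :: c' :: d' :: r, hh =>
    simp only [pathArcs, List.tail_cons, List.zip_cons_cons, List.mem_cons, forall_eq_or_imp,
      List.head?_cons, Option.some.injEq] at hh hS
    subst hh
    obtain rfl := ha _ hS.1
    obtain rfl := hb _ hS.2.1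
    obtain rfl := hc _ hS.2.2.1
    rcases r with _ | ⟨e, r⟩
    · rfl
    · exfalso
      have h1 : d' ∈ e :: r := by
        apply List.mem_of_getLast?
        simpa using hlast
      grind

lemma forall_mem_absorberTemplate {P : Fin 21 × Fin 21 × Fin 20 → Prop} [DecidablePred P]
    (h : absorberTemplate.all (fun t => decide (P t)) = true) : ∀ t ∈ absorberTemplate, P t := by
  simpa only [List.all_eq_true, decide_eq_true_eq] using h

section Uniqueness

variable {n : ℕ} {φ : Fin n → Fin n → Fin n} {ι : Type*} {𝓔 : ι → AbsorberCopy φ}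
  {L H : Finset (Fin n × Fin n)}

/-- The copies `𝓔 i` overlap only in root vertices and root colours, and the arcs of `L` leave them
only at terminal vertices, enter them only at initial vertices and use none of their colours. -/
structure IsSpreadFamily (𝓔 : ι → AbsorberCopy φ) (L : Finset (Fin n × Fin n)) : Prop where
  vert : ∀ i j s t, (𝓔 i).g s = (𝓔 j).g t → s = 0 ∧ t = 0 ∨ i = j ∧ s = t
  colour : ∀ i j s t, (𝓔 i).k s = (𝓔 j).k t → s = 0 ∧ t = 0 ∨ i = j ∧ s = t
  root : ∀ i j, (𝓔 i).g 0 = (𝓔 j).g 0 → (𝓔 i).k 0 = (𝓔 j).k 0 → i = j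
  link_tail : ∀ e ∈ L, ∀ i s, e.1 = (𝓔 i).g s → s = 6
  link_head : ∀ e ∈ L, ∀ i s, e.2 = (𝓔 i).g s → s = 1
  link_colour : ∀ e ∈ L, ∀ i s, φ e.1 e.2 ≠ (𝓔 i).k s

/-- Every arc of `H` lies in a copy `𝓔 i` or in `L`. -/
def IsCoveredBy (H : Finset (Fin n × Fin n)) (𝓔 : ι → AbsorberCopy φ)
    (L : Finset (Fin n × Fin n)) : Prop :=
  ∀ e ∈ H, (∃ i, ∃ t ∈ absorberTemplate, e = ((𝓔 i).g t.1, (𝓔 i).g t.2.1)) ∨ e ∈ L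

namespace IsSpreadFamily

variable (h𝓔 : IsSpreadFamily 𝓔 L) (hH : IsCoveredBy H 𝓔 L)
include h𝓔 hH

lemma exists_of_tail {i : ι} {s : Fin 21} {q : Fin n} (hs : s ≠ 6)
    (he : ((𝓔 i).g s, q) ∈ H) :
    ∃ j, ∃ t ∈ absorberTemplate, t.1 = s ∧ (s ≠ 0 → j = i) ∧ (𝓔 i).g s = (𝓔 j).g t.1 ∧
      q = (𝓔 j).g t.2.1 := by
  rcases hH _ he with ⟨j, t, ht, hte⟩ | hL
  · rw [Prod.mk.injEq] at hte
    refine ⟨j, t, ht, ?_, ?_, hte.1, hte.2⟩ <;>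
      rcases h𝓔.vert _ _ _ _ hte.1 with h | h <;> simp_all
  · exact absurd (h𝓔.link_tail _ hL i s rfl) hs

lemma exists_of_head {i : ι} {s : Fin 21} {p : Fin n} (hs : s ≠ 1)
    (he : (p, (𝓔 i).g s) ∈ H) :
    ∃ j, ∃ t ∈ absorberTemplate, t.2.1 = s ∧ (s ≠ 0 → j = i) ∧ p = (𝓔 j).g t.1 ∧
      (𝓔 i).g s = (𝓔 j).g t.2.1 := by
  rcases hH _ he with ⟨j, t, ht, hte⟩ | hL
  · rw [Prod.mk.injEq] at hte
    refine ⟨j, t, ht, ?_, ?_, hte.1, hte.2⟩ <;>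
      rcases h𝓔.vert _ _ _ _ hte.2 with h | h <;> simp_all
  · exact absurd (h𝓔.link_head _ hL i s rfl) hs

lemma exists_of_colour {i : ι} {s : Fin 20} {p q : Fin n} (hs : s ≠ 0)
    (he : (p, q) ∈ H) (hc : φ p q = (𝓔 i).k s) :
    ∃ t ∈ absorberTemplate, t.2.2 = s ∧ p = (𝓔 i).g t.1 ∧ q = (𝓔 i).g t.2.1 := by
  rcases hH _ he with ⟨j, t, ht, hte⟩ | hL
  · rw [Prod.mk.injEq] at hte
    obtain ⟨rfl, rfl⟩ := hte
    rw [(𝓔 j).colour_eq t ht] at hc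
    rcases h𝓔.colour _ _ _ _ hc with h | ⟨rfl, h⟩
    · exact absurd h.2 hs
    · exact ⟨t, ht, h, rfl, rfl⟩
  · exact absurd hc (h𝓔.link_colour _ hL i s)

/-- The vertices with a unique out-arc. -/
lemma eq_of_tail {i : ι} {s s' : Fin 21} {q : Fin n} (hs6 : s ≠ 6) (hs0 : s ≠ 0)
    (huniq : ∀ t ∈ absorberTemplate, t.1 = s → t.2.1 = s')
    (he : ((𝓔 i).g s, q) ∈ H) : q = (𝓔 i).g s' := by
  obtain ⟨j, t, ht, hts, hj, -, hq⟩ := h𝓔.exists_of_tail hH hs6 he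
  obtain rfl := hj hs0
  rw [hq, huniq t ht hts]

/-- The vertices with two out-arcs, one of whose heads is excluded. -/
lemma eq_of_tail_of_ne {i : ι} {s s' s'' : Fin 21} {q : Fin n} (hs6 : s ≠ 6) (hs0 : s ≠ 0)
    (huniq : ∀ t ∈ absorberTemplate, t.1 = s → t.2.1 = s' ∨ t.2.1 = s'')
    (hne : q ≠ (𝓔 i).g s'') (he : ((𝓔 i).g s, q) ∈ H) : q = (𝓔 i).g s' := by
  obtain ⟨j, t, ht, hts, hj, -, hq⟩ := h𝓔.exists_of_tail hH hs6 he
  obtain rfl := hj hs0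
  rcases huniq t ht hts with h | h
  · rw [hq, h]
  · exact absurd (hq.trans (by rw [h])) hne

/-- The vertices with two in-arcs, one of whose tails is excluded. -/
lemma eq_of_head_of_ne {i : ι} {s s' s'' : Fin 21} {p : Fin n} (hs1 : s ≠ 1) (hs0 : s ≠ 0)
    (huniq : ∀ t ∈ absorberTemplate, t.2.1 = s → t.1 = s' ∨ t.1 = s'')
    (hne : p ≠ (𝓔 i).g s'') (he : (p, (𝓔 i).g s) ∈ H) : p = (𝓔 i).g s' := by
  obtain ⟨j, t, ht, hts, hj, hp, -⟩ := h𝓔.exists_of_head hH hs1 he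
  obtain rfl := hj hs0
  rcases huniq t ht hts with h | h
  · rw [hp, h]
  · exact absurd (hp.trans (by rw [h])) hne

lemma gadget_eq {i : ι} {x : Fin 6 → Fin n}
    (hx : IsAbsGadget φ ((𝓔 i).g 0) ((𝓔 i).k 0) x)
    (hS : ∀ e ∈ ({(x 0, (𝓔 i).g 0), ((𝓔 i).g 0, x 1), (x 2, x 4), (x 3, x 5), (x 4, x 5)} :
      Finset (Fin n × Fin n)), e ∈ H) : x = (𝓔 i).g ∘ AbsorberCopy.gadgetIdx := by
  obtain ⟨hnd, h1, h2, h3, h4, -⟩ := hx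
  simp only [Finset.mem_insert, Finset.mem_singleton, forall_eq_or_imp, forall_eq] at hS
  obtain ⟨e1, e2, e3, e4, e5⟩ := hS
  simp only [List.nodup_cons, List.mem_cons, List.not_mem_nil, or_false, not_or, not_false_eq_true,
    List.nodup_nil, and_true] at hnd
  obtain ⟨j, t, ht, hts, -, hx0, hv⟩ := h𝓔.exists_of_head hH (by decide) e1
  obtain rfl := (forall_mem_absorberTemplate (by decide) :
      ∀ t ∈ absorberTemplate, t.2.1 = 0 → t = (1, 0, 1)) t ht hts
  dsimp only at hx0 hv
  have c1 : φ (x 3) (x 5) = (𝓔 j).k 1 := by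
    rw [← h1, hv, hx0]
    exact (𝓔 j).colour_eq _ ht
  obtain ⟨t, ht', hts', hx3, hx5⟩ := h𝓔.exists_of_colour hH (by decide) e4 c1
  have hx35 : x 3 = (𝓔 j).g 4 ∧ x 5 = (𝓔 j).g 6 := by
    rcases (forall_mem_absorberTemplate (by decide) :
      ∀ t ∈ absorberTemplate, t.2.2 = 1 → t = (1, 0, 1) ∨ t = (4, 6, 1))
      t ht' hts' with rfl | rfl
    · dsimp only at hx5
      rw [← hv] at hx5
      grind
    · exact ⟨hx3, hx5⟩
  clear hx3 hx5
  obtain ⟨hx3, hx5⟩ := hx35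
  rw [hx5] at e5
  have hx4 : x 4 = (𝓔 j).g 5 :=
    h𝓔.eq_of_head_of_ne (s'' := 4) hH (by decide) (by decide)
      (forall_mem_absorberTemplate (by decide)) (by grind) e5
  have hij : j = i := by
    refine h𝓔.root _ _ hv.symm ?_
    rw [← h4, hx4, hx5]
    exact ((𝓔 j).colour_eq (5, 6, 0) (by decide)).symm
  subst hij
  obtain ⟨l, t, ht, hts, -, hv', hx1⟩ := h𝓔.exists_of_tail hH (by decide) e2
  obtain rfl := (forall_mem_absorberTemplate (by decide) :
      ∀ t ∈ absorberTemplate, t.1 = 0 → t = (0, 2, 2)) t ht hts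
  dsimp only at hv' hx1
  have c2 : φ (x 2) (x 4) = (𝓔 l).k 2 := by
    rw [← h2, hv', hx1]
    exact (𝓔 l).colour_eq _ ht
  obtain ⟨t, ht', hts', hx2, hx4'⟩ := h𝓔.exists_of_colour hH (by decide) e3 c2
  rw [hx4] at hx4'
  rcases (forall_mem_absorberTemplate (by decide) :
      ∀ t ∈ absorberTemplate, t.2.2 = 2 → t = (0, 2, 2) ∨ t = (3, 5, 2))
      t ht' hts' with rfl | rfl
  · have := h𝓔.vert _ _ _ _ hx4'
    simp at this
  · obtain rfl : j = l := by
      have := h𝓔.vert _ _ _ _ hx4'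
      simpa using this
    funext a
    fin_cases a <;> simp [AbsorberCopy.gadgetIdx, hx0, hx1, hx2, hx3, hx4, hx5]

lemma bridge_eq {i : ι} {w : Fin 6 → Fin n}
    (hw : IsBridgeGadget φ ((𝓔 i).g 4) ((𝓔 i).g 5) w)
    (hmeet : absGadgetVerts ((𝓔 i).g 0) ((𝓔 i).g ∘ AbsorberCopy.gadgetIdx) ∩
      bridgeVerts ((𝓔 i).g 4) ((𝓔 i).g 5) w = {(𝓔 i).g 4, (𝓔 i).g 5})
    (hS : ∀ e ∈ ({((𝓔 i).g 4, w 0), (w 1, w 0), ((𝓔 i).g 5, w 2), (w 3, (𝓔 i).g 4), (w 3, w 4),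
      (w 5, (𝓔 i).g 5)} : Finset (Fin n × Fin n)), e ∈ H) :
    w = (𝓔 i).g ∘ AbsorberCopy.bridgeIdx := by
  obtain ⟨hnd, -⟩ := hw
  simp only [Finset.mem_insert, Finset.mem_singleton, forall_eq_or_imp, forall_eq] at hS
  obtain ⟨e1, e2, e3, e4, e5, e6⟩ := hS
  have hout : ∀ a, ∀ s ∈ ({0, 1, 2, 3, 4, 5, 6} : Finset (Fin 21)), w a ≠ (𝓔 i).g s := by
    intro a s hs hws
    have hmem : w a ∈ absGadgetVerts ((𝓔 i).g 0) ((𝓔 i).g ∘ AbsorberCopy.gadgetIdx) ∩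
        bridgeVerts ((𝓔 i).g 4) ((𝓔 i).g 5) w := by
      rw [Finset.mem_inter, AbsorberCopy.absGadgetVerts_eq, hws]
      refine ⟨Finset.mem_image_of_mem _ hs, ?_⟩
      rw [← hws]
      simp [bridgeVerts]
    rw [hmeet] at hmem
    simp only [List.nodup_cons, List.mem_cons, List.not_mem_nil, or_false, not_or,
      not_false_eq_true, List.nodup_nil, and_true] at hnd
    simp only [Finset.mem_insert, Finset.mem_singleton] at hmem
    fin_cases a <;> simp at hmem <;> grind
  have h0 : w 0 = (𝓔 i).g 7 :=
    h𝓔.eq_of_tail_of_ne (s'' := 6) hH (by decide) (by decide)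
      (forall_mem_absorberTemplate (by decide))
      (hout _ _ (by decide)) e1
  have h2 : w 2 = (𝓔 i).g 9 :=
    h𝓔.eq_of_tail_of_ne (s'' := 6) hH (by decide) (by decide)
      (forall_mem_absorberTemplate (by decide))
      (hout _ _ (by decide)) e3
  have h3 : w 3 = (𝓔 i).g 10 :=
    h𝓔.eq_of_head_of_ne (s'' := 3) hH (by decide) (by decide)
      (forall_mem_absorberTemplate (by decide))
      (hout _ _ (by decide)) e4
  have h5 : w 5 = (𝓔 i).g 12 :=
    h𝓔.eq_of_head_of_ne (s'' := 3) hH (by decide) (by decide)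
      (forall_mem_absorberTemplate (by decide))
      (hout _ _ (by decide)) e6
  rw [h0] at e2
  rw [h3] at e5
  have h1 : w 1 = (𝓔 i).g 8 :=
    h𝓔.eq_of_head_of_ne (s'' := 4) hH (by decide) (by decide)
      (forall_mem_absorberTemplate (by decide))
      (hout _ _ (by decide)) e2
  have h4 : w 4 = (𝓔 i).g 11 :=
    h𝓔.eq_of_tail_of_ne (s'' := 4) hH (by decide) (by decide)
      (forall_mem_absorberTemplate (by decide))
      (hout _ _ (by decide)) e5
  funext a
  fin_cases a <;> simp [AbsorberCopy.bridgeIdx, h0, h1, h2, h3, h4, h5]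

lemma path_eq {i : ι} {a b c d : Fin 21} {p : List (Fin n)}
    (hne : ∀ s ∈ [a, b, c], s ≠ 6 ∧ s ≠ 0 ∧ s ≠ d)
    (ha : ∀ t ∈ absorberTemplate, t.1 = a → t.2.1 = b)
    (hb : ∀ t ∈ absorberTemplate, t.1 = b → t.2.1 = c)
    (hc : ∀ t ∈ absorberTemplate, t.1 = c → t.2.1 = d)
    (hp : p.Nodup) (hhead : p.head? = some ((𝓔 i).g a)) (hlast : p.getLast? = some ((𝓔 i).g d))
    (hS : ∀ e ∈ pathArcs p, e ∈ H) : p = [a, b, c, d].map (𝓔 i).g := by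
  simp only [List.mem_cons, List.not_mem_nil, or_false, forall_eq_or_imp, forall_eq] at hne
  obtain ⟨⟨a6, a0, ad⟩, ⟨b6, b0, bd⟩, ⟨c6, c0, cd⟩⟩ := hne
  have hinj := (𝓔 i).g_inj
  exact path_eq_of_unique_out (hinj.ne ad) (hinj.ne bd) (hinj.ne cd)
    (fun q => h𝓔.eq_of_tail hH a6 a0 ha) (fun q => h𝓔.eq_of_tail hH b6 b0 hb)
    (fun q => h𝓔.eq_of_tail hH c6 c0 hc) hp hhead hlast hS

/-- The only absorber in `H` with the roots of `𝓔 i` is the one given by `𝓔 i`. -/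
theorem arcs_eq {i : ι} {v c : Fin n} (hv : (𝓔 i).g 0 = v) (hc : (𝓔 i).k 0 = c)
    (A : Absorber n φ v c) (hA : A.arcs ⊆ H) :
    A.arcs = ((𝓔 i).toAbsorber hv hc).arcs := by
  subst hv hc
  revert hA
  obtain ⟨x, w, P, hx, hw, hmeet, -, hnd, hends, -, -, -, -, -⟩ := A
  intro hA
  obtain ⟨s0, l0, s1, l1, s2, l2, s3, l3⟩ := hends
  have hxeq : x = (𝓔 i).g ∘ AbsorberCopy.gadgetIdx := by
    refine h𝓔.gadget_eq hH hx fun e he => hA ?_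
    simp only [Absorber.arcs, Finset.mem_union]
    refine Or.inl (Or.inl ?_)
    simp only [Finset.mem_insert, Finset.mem_singleton] at he ⊢
    tauto
  subst hxeq
  have hweq : w = (𝓔 i).g ∘ AbsorberCopy.bridgeIdx := by
    refine h𝓔.bridge_eq hH hw hmeet fun e he => hA ?_
    simp only [Absorber.arcs, Finset.mem_union]
    refine Or.inl (Or.inr ?_)
    simp only [Finset.mem_insert, Finset.mem_singleton] at he ⊢
    simp only [Function.comp, AbsorberCopy.gadgetIdx] at he ⊢
    tauto
  subst hweq
  have hP : ∀ j, ∀ e ∈ pathArcs (P j), e ∈ H := by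
    intro j e he
    refine hA ?_
    simp only [Absorber.arcs, Finset.mem_union]
    refine Or.inr ?_
    simp only [Finset.mem_biUnion, Finset.mem_univ, true_and, List.mem_toFinset]
    exact ⟨j, he⟩
  have hPeq : P = fun j => (AbsorberCopy.pathIdx j).map (𝓔 i).g := by
    funext j
    fin_cases j
    · exact h𝓔.path_eq hH (by decide) (forall_mem_absorberTemplate (by decide))
        (forall_mem_absorberTemplate (by decide)) (forall_mem_absorberTemplate (by decide))
        (hnd 0) s0 l0 (hP 0)
    · exact h𝓔.path_eq hH (by decide) (forall_mem_absorberTemplate (by decide))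
        (forall_mem_absorberTemplate (by decide)) (forall_mem_absorberTemplate (by decide))
        (hnd 1) s1 l1 (hP 1)
    · exact h𝓔.path_eq hH (by decide) (forall_mem_absorberTemplate (by decide))
        (forall_mem_absorberTemplate (by decide)) (forall_mem_absorberTemplate (by decide))
        (hnd 2) s2 l2 (hP 2)
    · exact h𝓔.path_eq hH (by decide) (forall_mem_absorberTemplate (by decide))
        (forall_mem_absorberTemplate (by decide)) (forall_mem_absorberTemplate (by decide))
        (hnd 3) s3 l3 (hP 3)
  subst hPeq
  rfl

end IsSpreadFamily

end Uniqueness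

/-- Greedy choice: if each `i` has an option avoiding any given set that is not too large, then
options can be chosen pairwise disjointly. -/
lemma exists_pairwise_disjoint_choice {ι τ : Type*} [Fintype ι] [DecidableEq τ] {κ : ι → Type*}
    (El : ∀ i, κ i → Finset τ) (s : ℕ) (F₀ : Finset τ)
    (h : ∀ i (F : Finset τ), F.card ≤ F₀.card + s * Fintype.card ι →
      ∃ o : κ i, (El i o).card ≤ s ∧ Disjoint (El i o) F) :
    ∃ f : ∀ i, κ i, (∀ i, (El i (f i)).card ≤ s) ∧ (∀ i, Disjoint (El i (f i)) F₀) ∧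
      ∀ i j, i ≠ j → Disjoint (El i (f i)) (El j (f j)) := by
  have key : ∀ S : Finset ι, ∃ f : ∀ i, κ i, (∀ i ∈ S, (El i (f i)).card ≤ s) ∧
      (∀ i ∈ S, Disjoint (El i (f i)) F₀) ∧
      ∀ i ∈ S, ∀ j ∈ S, i ≠ j → Disjoint (El i (f i)) (El j (f j)) := by
    intro S
    induction S using Finset.induction_on with
    | empty =>
      choose f _ using fun i => h i ∅ (by simp)
      exact ⟨f, by simp⟩
    | insert a S ha ih =>
      obtain ⟨f, h1, h2, h3⟩ := ih
      obtain ⟨o, ho1, ho2⟩ := h a (F₀ ∪ S.biUnion fun i => El i (f i)) (by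
        refine (Finset.card_union_le _ _).trans (Nat.add_le_add_left ?_ _)
        refine (Finset.card_biUnion_le_card_mul S _ s h1).trans ?_
        rw [mul_comm]
        exact Nat.mul_le_mul_left _ (Finset.card_le_univ S))
      rw [Finset.disjoint_union_right, Finset.disjoint_biUnion_right] at ho2
      have hne : ∀ i ∈ S, i ≠ a := fun i hi hia => ha (hia ▸ hi)
      refine ⟨Function.update f a o, ?_, ?_, ?_⟩
      · intro i hi
        rcases Finset.mem_insert.1 hi with rfl | hi'
        · simpa using ho1
        · simpa [hne i hi'] using h1 i hi'
      · intro i hi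
        rcases Finset.mem_insert.1 hi with rfl | hi'
        · simpa using ho2.1
        · simpa [hne i hi'] using h2 i hi'
      · intro i hi j hj hij
        rcases Finset.mem_insert.1 hi with rfl | hi' <;>
          rcases Finset.mem_insert.1 hj with rfl | hj'
        · exact absurd rfl hij
        · simpa [hne j hj'] using ho2.2 j hj'
        · simpa [hne i hi'] using (ho2.2 i hi').symm
        · simpa [hne i hi', hne j hj'] using h3 i hi' j hj' hij
  obtain ⟨f, h1, h2, h3⟩ := key Finset.univ
  exact ⟨f, fun i => h1 i (Finset.mem_univ i), fun i => h2 i (Finset.mem_univ i),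
    fun i j => h3 i (Finset.mem_univ i) j (Finset.mem_univ j)⟩

/-- If each of the sets `bad t` meets `𝒜` in at most `N` elements and there are too few of them to
cover `𝒜`, then some element of `𝒜` is in none. -/
lemma exists_mem_forall_not {κ τ : Type*} (𝒜 : Finset κ) (F : Finset τ) (bad : τ → κ → Prop)
    (N : ℕ) (h : ∀ t ∈ F, ∀ S ⊆ 𝒜, (∀ x ∈ S, bad t x) → S.card ≤ N) (hcard : F.card * N < 𝒜.card) :
    ∃ x ∈ 𝒜, ∀ t ∈ F, ¬ bad t x := by
  by_contra! hcon
  have hsub : 𝒜 ⊆ F.biUnion fun t => 𝒜.filter (bad t) := by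
    intro x hx
    obtain ⟨t, ht, hb⟩ := hcon x hx
    exact Finset.mem_biUnion.2 ⟨t, ht, Finset.mem_filter.2 ⟨hx, hb⟩⟩
  exact absurd ((Finset.card_le_card hsub).trans (Finset.card_biUnion_le_card_mul F _ N fun t ht =>
      h t ht _ (Finset.filter_subset _ _) fun x hx => (Finset.mem_filter.1 hx).2))
    (not_le.2 hcard)

section Greedy

variable {n : ℕ} {φ : Fin n → Fin n → Fin n}

/-- A rainbow path of length three between two given vertices that avoids few given vertices and
colours. -/
lemma IsProper.exists_rainbow_path (hφ : IsProper φ) (a b : Fin n)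
    (FV FC : Finset (Fin n)) (h : 3 * (FV.card + FC.card) + 4 < n) :
    ∃ u u' : Fin n, (u ∉ FV ∧ u' ∉ FV ∧ u ≠ u') ∧
      ([φ a u, φ u u', φ u' b] : List (Fin n)).Nodup ∧
      φ a u ∉ FC ∧ φ u u' ∉ FC ∧ φ u' b ∉ FC := by
  obtain ⟨hr, hc⟩ := hφ
  let bad : (Fin n ⊕ Fin n) ⊕ (Fin n ⊕ Fin n ⊕ Fin n) ⊕ Fin 4 → Fin n × Fin n → Prop :=
    Sum.elim
      (Sum.elim (fun t p => p.1 = t) (fun t p => p.2 = t))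
      (Sum.elim
        (Sum.elim (fun t p => φ a p.1 = t)
          (Sum.elim (fun t p => φ p.1 p.2 = t) (fun t p => φ p.2 b = t)))
        ![fun p => p.1 = p.2, fun p => φ a p.1 = φ p.1 p.2, fun p => φ p.1 p.2 = φ p.2 b,
          fun p => φ a p.1 = φ p.2 b])
  let F : Finset ((Fin n ⊕ Fin n) ⊕ (Fin n ⊕ Fin n ⊕ Fin n) ⊕ Fin 4) :=
    (FV.disjSum FV).disjSum ((FC.disjSum (FC.disjSum FC)).disjSum Finset.univ)
  have hF : F.card = 2 * FV.card + 3 * FC.card + 4 := by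
    simp only [F, Finset.card_disjSum, Finset.card_univ, Fintype.card_fin]
    ring
  have inj1 : ∀ P : Fin n × Fin n → Prop, (∀ x y z, P (z, x) → P (z, y) → x = y) →
      ∀ S ⊆ Finset.univ, (∀ p ∈ S, P p) → S.card ≤ n := fun P hP S _ hS => by
    simpa using Finset.card_le_card_of_injOn (s := S) (t := Finset.univ)
      Prod.fst (by simp) fun ⟨p, q⟩ h1 ⟨p', q'⟩ h2 h3 => by
        obtain rfl : p = p' := h3
        rw [hP q q' p (hS _ h1) (hS _ h2)]
  have inj2 : ∀ P : Fin n × Fin n → Prop, (∀ x y z, P (x, z) → P (y, z) → x = y) →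
      ∀ S ⊆ Finset.univ, (∀ p ∈ S, P p) → S.card ≤ n := fun P hP S _ hS => by
    simpa using Finset.card_le_card_of_injOn (s := S) (t := Finset.univ)
      Prod.snd (by simp) fun ⟨p, q⟩ h1 ⟨p', q'⟩ h2 h3 => by
        obtain rfl : q = q' := h3
        rw [hP p p' q (hS _ h1) (hS _ h2)]
  obtain ⟨⟨u, u'⟩, -, hp⟩ := exists_mem_forall_not Finset.univ F bad n (by
    rintro ((t | t) | (t | t | t) | t) -
    · exact inj2 _ fun x y z (h1 : x = t) (h2 : y = t) => h1.trans h2.symm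
    · exact inj1 _ fun x y z (h1 : x = t) (h2 : y = t) => h1.trans h2.symm
    · exact inj2 _ fun x y z (h1 : φ a x = t) (h2 : φ a y = t) => hr a _ _ (h1.trans h2.symm)
    · exact inj1 _ fun x y z (h1 : φ z x = t) (h2 : φ z y = t) => hr z _ _ (h1.trans h2.symm)
    · exact inj1 _ fun x y z (h1 : φ x b = t) (h2 : φ y b = t) => hc _ _ b (h1.trans h2.symm)
    · fin_cases t
      · exact inj1 _ fun x y z (h1 : z = x) (h2 : z = y) => h1.symm.trans h2
      · exact inj1 _ fun x y z (h1 : φ a z = φ z x) (h2 : φ a z = φ z y) =>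
          hr z _ _ (h1.symm.trans h2)
      · exact inj2 _ fun x y z (h1 : φ x z = φ z b) (h2 : φ y z = φ z b) =>
          hc _ _ z (h1.trans h2.symm)
      · exact inj1 _ fun x y z (h1 : φ a z = φ x b) (h2 : φ a z = φ y b) =>
          hc _ _ b (h1.symm.trans h2)) (by
    rw [hF, Finset.card_univ, Fintype.card_prod, Fintype.card_fin]
    exact Nat.mul_lt_mul_of_pos_right (by omega) (by omega))
  have q0 : u ≠ u' := hp (.inr (.inr 0)) (by simp [F])
  have q1 : φ a u ≠ φ u u' := hp (.inr (.inr 1)) (by simp [F])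
  have q2 : φ u u' ≠ φ u' b := hp (.inr (.inr 2)) (by simp [F])
  have q3 : φ a u ≠ φ u' b := hp (.inr (.inr 3)) (by simp [F])
  refine ⟨u, u', ⟨fun h => ?_, fun h => ?_, q0⟩, by simp [q1, q2, q3], fun h => ?_, fun h => ?_,
    fun h => ?_⟩
  · exact hp (.inl (.inl u)) (by simpa [F] using h) rfl
  · exact hp (.inl (.inr u')) (by simpa [F] using h) rfl
  · exact hp (.inr (.inl (.inl _))) (by simpa [F] using h) rfl
  · exact hp (.inr (.inl (.inr (.inl _)))) (by simpa [F] using h) rfl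
  · exact hp (.inr (.inl (.inr (.inr _)))) (by simpa [F] using h) rfl

/-- A `(v, c)`-absorbing gadget meeting given small sets only in `v` and `c`. -/
lemma HasAbsGadgets.exists_avoiding (hA : HasAbsGadgets φ) (v c : Fin n) (FV FC : Finset (Fin n))
    (h : (FV.card + FC.card) * 10 ^ 50 < n) :
    ∃ x, IsAbsGadget φ v c x ∧ (∀ u ∈ FV, u ∈ absGadgetVerts v x → u = v) ∧
      ∀ d ∈ FC, absGadgetHasColour φ v x d → d = c := by
  obtain ⟨𝒜, h1, ⟨h2, h3⟩, h4⟩ := hA v c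
  obtain ⟨x, hx, hx'⟩ := exists_mem_forall_not 𝒜 ((FV.erase v).disjSum (FC.erase c))
    (Sum.elim (fun u x => u ∈ absGadgetVerts v x) (fun d x => absGadgetHasColour φ v x d)) n
    (by
      rintro (u | d) hu S hS hb
      · refine (Finset.card_le_card fun x hx => ?_).trans (h2 u ?_)
        · exact Finset.mem_filter.2 ⟨hS hx, hb x hx⟩
        simp at hu
        exact hu.1
      · refine (Finset.card_le_card fun x hx => Finset.mem_filter.2 ⟨hS hx, hb x hx⟩).trans
          (h3 d ?_)
        simp at hu
        exact hu.1)
    (by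
      rw [Finset.card_disjSum]
      have hle : (FV.erase v).card + (FC.erase c).card ≤ FV.card + FC.card :=
        Nat.add_le_add (Finset.card_erase_le) (Finset.card_erase_le)
      refine (Nat.mul_le_mul_right n hle).trans_lt ?_
      have h' : ((FV.card + FC.card : ℕ) : ℝ) * 10 ^ 50 < n := by exact_mod_cast h
      have hn : (0 : ℝ) < n := lt_of_le_of_lt (by positivity) h'
      rw [← Nat.cast_lt (α := ℝ)]
      refine lt_of_lt_of_le ?_ h4
      rw [lt_div_iff₀ (by positivity), Nat.cast_mul]
      have h'' : ((FV.card + FC.card : ℕ) : ℝ) * 2 ^ 100 < n :=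
        lt_of_le_of_lt (mul_le_mul_of_nonneg_left (by norm_num) (by positivity)) h'
      nlinarith)
  refine ⟨x, h1 x hx, fun u hu hux => ?_, fun d hd hdx => ?_⟩
  · by_contra hne
    exact hx' (.inl u) (by simp [hne, hu]) hux
  · by_contra hne
    exact hx' (.inr d) (by simp [hne, hd]) hdx

/-- A `(y, z)`-bridging gadget meeting given small sets only in `y` and `z`. -/
lemma HasBridgeGadgets.exists_avoiding (hB : HasBridgeGadgets φ) {y z : Fin n} (hyz : y ≠ z)
    (FV FC : Finset (Fin n)) (h : (FV.card + FC.card) * 10 ^ 50 < n) :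
    ∃ w, IsBridgeGadget φ y z w ∧ (∀ u ∈ FV, u ∈ bridgeVerts y z w → u = y ∨ u = z) ∧
      ∀ d ∈ FC, ¬ bridgeHasColour φ y z w d := by
  obtain ⟨ℬ, h1, ⟨h2, h3⟩, h4⟩ := hB y z hyz
  obtain ⟨x, hx, hx'⟩ := exists_mem_forall_not ℬ (((FV.erase y).erase z).disjSum FC)
    (Sum.elim (fun u x => u ∈ bridgeVerts y z x) (fun d x => bridgeHasColour φ y z x d)) n
    (by
      rintro (u | d) hu S hS hb
      · simp at hu
        refine (Finset.card_le_card fun x hx => ?_).trans (h2 u hu.2.1 hu.1)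
        exact Finset.mem_filter.2 ⟨hS hx, hb x hx⟩
      · exact (Finset.card_le_card fun x hx => Finset.mem_filter.2 ⟨hS hx, hb x hx⟩).trans (h3 d))
    (by
      rw [Finset.card_disjSum]
      have hle : ((FV.erase y).erase z).card + FC.card ≤ FV.card + FC.card :=
        Nat.add_le_add_right (Finset.card_erase_le.trans Finset.card_erase_le) _
      refine (Nat.mul_le_mul_right n hle).trans_lt ?_
      have h' : ((FV.card + FC.card : ℕ) : ℝ) * 10 ^ 50 < n := by exact_mod_cast h
      have hn : (0 : ℝ) < n := lt_of_le_of_lt (by positivity) h'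
      rw [← Nat.cast_lt (α := ℝ)]
      refine lt_of_lt_of_le ?_ h4
      rw [lt_div_iff₀ (by positivity), Nat.cast_mul]
      nlinarith)
  refine ⟨x, h1 x hx, fun u hu hux => ?_, fun d hd hdx => hx' (.inr d) (by simp [hd]) hdx⟩
  by_contra! hne
  exact hx' (.inl u) (by simp [hne, hu]) hux

/-- Extension of duplicate-free lists of vertices and colours by a fresh rainbow path. -/
lemma IsProper.exists_rainbow_path_append (hφ : IsProper φ) (FV FC : Finset (Fin n))
    {LV LC : List (Fin n)} (hLV : LV.Nodup) (hLC : LC.Nodup) (a b : Fin n)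
    (h : 3 * (FV.card + LV.length + (FC.card + LC.length)) + 4 < n) :
    ∃ u u' : Fin n, (LV ++ [u, u']).Nodup ∧ (LC ++ [φ a u, φ u u', φ u' b]).Nodup ∧
      u ∉ FV ∧ u' ∉ FV ∧ φ a u ∉ FC ∧ φ u u' ∉ FC ∧ φ u' b ∉ FC := by
  have h1 : (FV ∪ LV.toFinset).card ≤ FV.card + LV.length :=
    (Finset.card_union_le _ _).trans (Nat.add_le_add_left (List.toFinset_card_le LV) _)
  have h2 : (FC ∪ LC.toFinset).card ≤ FC.card + LC.length :=
    (Finset.card_union_le _ _).trans (Nat.add_le_add_left (List.toFinset_card_le LC) _)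
  obtain ⟨u, u', ⟨hu, hu', hne⟩, hnd, hc1, hc2, hc3⟩ :=
    hφ.exists_rainbow_path a b (FV ∪ LV.toFinset) (FC ∪ LC.toFinset) (by omega)
  simp only [Finset.mem_union, List.mem_toFinset, not_or] at hu hu' hc1 hc2 hc3
  refine ⟨u, u', hLV.append (by simpa using hne) ?_, hLC.append hnd ?_, hu.1, hu'.1, hc1.1, hc2.1,
    hc3.1⟩
  · simp [hu.2, hu'.2]
  · simp [hc1.2, hc2.2, hc3.2]

/-- A copy of the absorber template with given roots that avoids small sets of other vertices and
colours. -/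
lemma exists_absorberCopy (hφ : IsProper φ) (hA : HasAbsGadgets φ) (hB : HasBridgeGadgets φ)
    (v c : Fin n) (FV FC : Finset (Fin n)) (h : (FV.card + FC.card + 50) * 10 ^ 50 < n) :
    ∃ E : AbsorberCopy φ, E.g 0 = v ∧ E.k 0 = c ∧ (∀ s, s ≠ 0 → E.g s ∉ FV) ∧
      ∀ s, s ≠ 0 → E.k s ∉ FC := by
  have hsmall : (FV.card + FC.card + 50) * 4 < n :=
    lt_of_le_of_lt (Nat.mul_le_mul_left _ (by norm_num)) h
  obtain ⟨x, ⟨hxn, hx1, hx2, hx3, hx4, hxc⟩, hxV, hxC⟩ :=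
    hA.exists_avoiding v c FV FC
      (lt_of_le_of_lt (Nat.mul_le_mul_right _ (by clear h; omega)) h)
  have hne : x 3 ≠ x 4 := by
    intro h34
    simp [h34] at hxn
  have hLV : [v, x 0, x 1, x 2, x 3, x 4, x 5].toFinset.card ≤ 7 := List.toFinset_card_le _
  have hLC : [c, φ (x 0) v, φ v (x 1), φ (x 0) (x 1)].toFinset.card ≤ 4 :=
    List.toFinset_card_le _
  obtain ⟨w, ⟨hwn, hw1, hw2, hw3, hw4, hwc⟩, hwV, hwC⟩ := hB.exists_avoiding hne
    (FV ∪ [v, x 0, x 1, x 2, x 3, x 4, x 5].toFinset)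
    (FC ∪ [c, φ (x 0) v, φ v (x 1), φ (x 0) (x 1)].toFinset) (by
      have h1 := Finset.card_union_le FV [v, x 0, x 1, x 2, x 3, x 4, x 5].toFinset
      have h2 := Finset.card_union_le FC [c, φ (x 0) v, φ v (x 1), φ (x 0) (x 1)].toFinset
      exact lt_of_le_of_lt (Nat.mul_le_mul_right _ (by clear h; omega)) h)
  clear h
  have hxFV : ∀ i, x i ∉ FV := by
    intro i hi
    have hv : x i = v := hxV _ hi (by simp [absGadgetVerts])
    fin_cases i <;> simp at hv <;> simp [hv] at hxn
  have hwV' : ∀ i, w i ∉ FV ∪ [v, x 0, x 1, x 2, x 3, x 4, x 5].toFinset := by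
    intro i hi
    have hv : w i = x 3 ∨ w i = x 4 := hwV _ hi (by simp [bridgeVerts])
    clear hxn hwV hi
    fin_cases i <;> simp at hv <;> rcases hv with hv | hv <;> simp [hv] at hwn
  have hwFV : ∀ i, w i ∉ FV := fun i hi => hwV' i (Finset.mem_union_left _ hi)
  have hwx : ∀ i, w i ∉ [v, x 0, x 1, x 2, x 3, x 4, x 5] := fun i hi =>
    hwV' i (Finset.mem_union_right _ (List.mem_toFinset.2 hi))
  have hVn : ([v, x 0, x 1, x 2, x 3, x 4, x 5] ++ [w 0, w 1, w 2, w 3, w 4, w 5]).Nodup := by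
    refine hxn.append ?_ ?_
    · exact (List.nodup_cons.1 (List.nodup_cons.1 hwn).2).2
    · intro a ha hb
      simp only [List.mem_cons, List.not_mem_nil, or_false] at hb
      rcases hb with rfl | rfl | rfl | rfl | rfl | rfl <;> exact hwx _ ha
  have hwC' : ∀ d, bridgeHasColour φ (x 3) (x 4) w d →
      d ∉ FC ∧ d ∉ [c, φ (x 0) v, φ v (x 1), φ (x 0) (x 1)] := fun d hd =>
    ⟨fun h => hwC d (Finset.mem_union_left _ h) hd,
      fun h => hwC d (Finset.mem_union_right _ (List.mem_toFinset.2 h)) hd⟩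
  have hd1 := hwC' (φ (x 3) (w 0)) (by simp [bridgeHasColour])
  have hd2 := hwC' (φ (w 1) (w 0)) (by simp [bridgeHasColour])
  have hd3 := hwC' (φ (w 3) (x 3)) (by simp [bridgeHasColour])
  have hd4 := hwC' (φ (w 3) (w 4)) (by simp [bridgeHasColour])
  have hxC' : ∀ d, absGadgetHasColour φ v x d → d ≠ c → d ∉ FC := fun d hd hdc h =>
    hdc (hxC d h hd)
  have hcn : [c, φ (x 0) v, φ v (x 1), φ (x 0) (x 1)].Nodup :=
    (List.perm_append_comm (l₁ := [φ (x 0) v, φ v (x 1), φ (x 0) (x 1)]) (l₂ := [c])).nodup_iff.1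
      hxc
  have hf : ∀ d ∈ [φ (x 0) v, φ v (x 1), φ (x 0) (x 1)], d ≠ c := fun d hd hdc =>
    (List.nodup_cons.1 hcn).1 (hdc ▸ hd)
  have hf1 := hxC' (φ (x 0) v) (by simp [absGadgetHasColour]) (hf _ (by simp))
  have hf2 := hxC' (φ v (x 1)) (by simp [absGadgetHasColour]) (hf _ (by simp))
  have hf3 := hxC' (φ (x 0) (x 1)) (by simp [absGadgetHasColour]) (hf _ (by simp))
  have hCn : ([c, φ (x 0) v, φ v (x 1), φ (x 0) (x 1)] ++
      [φ (x 3) (w 0), φ (w 1) (w 0), φ (w 3) (x 3), φ (w 3) (w 4)]).Nodup := by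
    refine hcn.append hwc ?_
    intro a ha hb
    simp only [List.mem_cons, List.not_mem_nil, or_false] at hb
    rcases hb with rfl | rfl | rfl | rfl
    exacts [hd1.2 ha, hd2.2 ha, hd3.2 ha, hd4.2 ha]
  obtain ⟨p₁, q₁, hV₁, hC₁, hp₁, hq₁, hr₁, hs₁, ht₁⟩ :=
    hφ.exists_rainbow_path_append FV FC hVn hCn (x 1) (x 2) (by simp; omega)
  obtain ⟨p₂, q₂, hV₂, hC₂, hp₂, hq₂, hr₂, hs₂, ht₂⟩ :=
    hφ.exists_rainbow_path_append FV FC hV₁ hC₁ (w 0) (w 3) (by simp; omega)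
  obtain ⟨p₃, q₃, hV₃, hC₃, hp₃, hq₃, hr₃, hs₃, ht₃⟩ :=
    hφ.exists_rainbow_path_append FV FC hV₂ hC₂ (w 4) (w 1) (by simp; omega)
  obtain ⟨p₄, q₄, hV₄, hC₄, hp₄, hq₄, hr₄, hs₄, ht₄⟩ :=
    hφ.exists_rainbow_path_append FV FC hV₃ hC₃ (w 2) (w 5) (by simp; omega)
  refine ⟨{
    g := ![v, x 0, x 1, x 2, x 3, x 4, x 5, w 0, w 1, w 2, w 3, w 4, w 5,
      p₁, q₁, p₂, q₂, p₃, q₃, p₄, q₄]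
    k := ![c, φ (x 0) v, φ v (x 1), φ (x 0) (x 1),
      φ (x 3) (w 0), φ (w 1) (w 0), φ (w 3) (x 3), φ (w 3) (w 4),
      φ (x 1) p₁, φ p₁ q₁, φ q₁ (x 2), φ (w 0) p₂, φ p₂ q₂, φ q₂ (w 3),
      φ (w 4) p₃, φ p₃ q₃, φ q₃ (w 1), φ (w 2) p₄, φ p₄ q₄, φ q₄ (w 5)]
    g_inj := List.nodup_ofFn.1 hV₄
    k_inj := List.nodup_ofFn.1 hC₄
    colour_eq := ?_ }, rfl, rfl, ?_, ?_⟩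
  · simp only [absorberTemplate, List.forall_mem_cons]
    exact ⟨rfl, rfl, rfl, hx3.symm, hx2.symm, hx1.symm, hx4, rfl, rfl, hw3.symm, hw4.symm, rfl,
      rfl, hw1.symm, hw2.symm, rfl, rfl, rfl, rfl, rfl, rfl, rfl, rfl, rfl, rfl, rfl, rfl,
      fun _ h => absurd h List.not_mem_nil⟩
  · intro s hs
    fin_cases s
    exacts [absurd rfl hs, hxFV 0, hxFV 1, hxFV 2, hxFV 3, hxFV 4, hxFV 5, hwFV 0, hwFV 1, hwFV 2,
      hwFV 3, hwFV 4, hwFV 5, hp₁, hq₁, hp₂, hq₂, hp₃, hq₃, hp₄, hq₄]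
  · intro s hs
    fin_cases s
    exacts [absurd rfl hs, hf1, hf2, hf3, hd1.1, hd2.1, hd3.1, hd4.1, hr₁, hs₁, ht₁, hr₂, hs₂, ht₂,
      hr₃, hs₃, ht₃, hr₄, hs₄, ht₄]

end Greedy

section Assembly

variable {n : ℕ} {φ : Fin n → Fin n → Fin n}

lemma disjoint_disjSum_left_iff {σ τ : Type*} {A : Finset σ} {B : Finset τ}
    {F : Finset (σ ⊕ τ)} :
    Disjoint (A.disjSum B) F ↔ Disjoint A F.toLeft ∧ Disjoint B F.toRight := by
  simp [Finset.disjoint_left, Finset.mem_disjSum]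

/-- Sets of equal size can be matched by an injection that also matches given subsets of equal
size. -/
lemma exists_injective_image_eq {σ τ : Type*} [Fintype σ] [Nonempty τ]
    {A : Finset σ} {U V : Finset τ} (hVU : V ⊆ U) (hU : Fintype.card σ = U.card)
    (hV : A.card = V.card) :
    ∃ f : σ → τ, Function.Injective f ∧ Finset.univ.image f = U ∧ A.image f = V := by
  obtain ⟨f, hf⟩ := A.finite_toSet.exists_bijOn_of_encard_eq (t := (V : Set τ)) (by
    simp [Set.encard_coe_eq_coe_finsetCard, hV])
  have hfV : A.image f = V := by
    rw [← Finset.coe_inj, Finset.coe_image, hf.image_eq]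
  obtain ⟨g, hg⟩ := Finset.exists_equiv_extend_of_card_eq hU (hfV.subset.trans hVU) hf.injOn
  refine ⟨fun a => g a, Subtype.val_injective.comp g.injective, ?_, ?_⟩
  · ext x
    simp only [Finset.mem_image, Finset.mem_univ, true_and]
    exact ⟨fun ⟨a, ha⟩ => ha ▸ (g a).2, fun hx => ⟨g.symm ⟨x, hx⟩, by simp⟩⟩
  · rw [← hfV]
    exact Finset.image_congr hg

/-- The size bound needed for the greedy construction follows from `m < n / log n`. -/
lemma eventually_template_size_lt :
    ∃ n₀ : ℕ, ∀ n : ℕ, n₀ ≤ n → ∀ m : ℕ, (m : ℝ) < n / Real.log n →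
      (7 * m + 7 * m + 39 * (7 * m * 256) + 50) * 10 ^ 50 < n := by
  obtain ⟨n₀, hn₀⟩ := Filter.eventually_atTop.1
    ((Real.tendsto_log_atTop.comp tendsto_natCast_atTop_atTop).eventually_ge_atTop
      ((10 : ℝ) ^ 6 * 10 ^ 50))
  refine ⟨n₀, fun n hn m hm => ?_⟩
  have hlog : (10 : ℝ) ^ 6 * 10 ^ 50 ≤ Real.log n := hn₀ n hn
  have hpos : 0 < Real.log n := lt_of_lt_of_le (by positivity) hlog
  have h1 : (10 : ℝ) ^ 6 * 10 ^ 50 ≤ n := hlog.trans (Real.log_le_self n.cast_nonneg)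
  have h2 : (m : ℝ) * (10 ^ 6 * 10 ^ 50) ≤ n :=
    (mul_le_mul_of_nonneg_left hlog m.cast_nonneg).trans ((lt_div_iff₀ hpos).1 hm).le
  have hK : 0 < (10 : ℕ) ^ 50 := by positivity
  have h1' : 10 ^ 6 * 10 ^ 50 ≤ n := by exact_mod_cast h1
  have h2' : m * (10 ^ 6 * 10 ^ 50) ≤ n := by exact_mod_cast h2
  clear h1 h2 hlog hpos hm hn
  generalize (10 : ℕ) ^ 50 = K at *
  nlinarith

/-- A family of copies of the absorber template with prescribed roots, disjoint apart from their
roots and avoiding small sets of other vertices and colours. -/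
lemma exists_absorberCopy_family {ι : Type*} [Fintype ι] (hφ : IsProper φ)
    (hA : HasAbsGadgets φ) (hB : HasBridgeGadgets φ) (v c : ι → Fin n) (FV FC : Finset (Fin n))
    (h : (FV.card + FC.card + 39 * Fintype.card ι + 50) * 10 ^ 50 < n) :
    ∃ 𝓔 : ι → AbsorberCopy φ, (∀ i, (𝓔 i).g 0 = v i) ∧ (∀ i, (𝓔 i).k 0 = c i) ∧
      (∀ i s, s ≠ 0 → (𝓔 i).g s ∉ FV) ∧ (∀ i s, s ≠ 0 → (𝓔 i).k s ∉ FC) ∧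
      (∀ i j s t, s ≠ 0 → t ≠ 0 → (𝓔 i).g s = (𝓔 j).g t → i = j) ∧
      ∀ i j s t, s ≠ 0 → t ≠ 0 → (𝓔 i).k s = (𝓔 j).k t → i = j := by
  obtain ⟨f, -, h1, h2⟩ := exists_pairwise_disjoint_choice
    (κ := fun i => {E : AbsorberCopy φ // E.g 0 = v i ∧ E.k 0 = c i})
    (fun i E => ((Finset.univ.erase 0).image E.1.g).disjSum ((Finset.univ.erase 0).image E.1.k))
    39 (FV.disjSum FC) (by
      intro i F hF
      rw [Finset.card_disjSum, ← Finset.card_toLeft_add_card_toRight] at hF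
      obtain ⟨E, hv, hc, hEV, hEC⟩ := exists_absorberCopy hφ hA hB (v i) (c i) F.toLeft F.toRight
        (lt_of_le_of_lt (Nat.mul_le_mul_right _ (Nat.add_le_add_right hF _)) h)
      refine ⟨⟨E, hv, hc⟩, ?_, ?_⟩
      · rw [Finset.card_disjSum]
        exact Nat.add_le_add (b := 20) (d := 19) Finset.card_image_le Finset.card_image_le
      · rw [disjoint_disjSum_left_iff]
        constructor <;> rw [Finset.disjoint_left]
        · simpa using hEV
        · simpa using hEC)
  simp only [disjoint_disjSum_left_iff, Finset.toLeft_disjSum, Finset.toRight_disjSum] at h1 h2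
  simp only [Finset.disjoint_left, Finset.mem_image, Finset.mem_erase, Finset.mem_univ, and_true,
    forall_exists_index, and_imp] at h1 h2
  refine ⟨fun i => (f i).1, fun i => (f i).2.1, fun i => (f i).2.2,
    fun i s hs => (h1 i).1 s hs rfl, fun i s hs => (h1 i).2 s hs rfl, ?_, ?_⟩
  · intro i j s t hs ht hst
    by_contra hij
    exact (h2 i j hij).1 s hs rfl ⟨t, ht, hst.symm⟩
  · intro i j s t hs ht hst
    by_contra hij
    exact (h2 i j hij).2 s hs rfl ⟨t, ht, hst.symm⟩

/-- A disjoint family of rainbow directed paths of length three with prescribed ends, avoiding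
small sets of internal vertices and colours. -/
lemma exists_link_family {ι : Type*} [Fintype ι] (hφ : IsProper φ) (a b : ι → Fin n)
    (FV FC : Finset (Fin n)) (h : 3 * (FV.card + FC.card + 5 * Fintype.card ι) + 4 < n) :
    ∃ u u' : ι → Fin n, (∀ i, u i ∉ FV ∧ u' i ∉ FV ∧ u i ≠ u' i) ∧
      (∀ i, [φ (a i) (u i), φ (u i) (u' i), φ (u' i) (b i)].Nodup) ∧
      (∀ i, ∀ d ∈ [φ (a i) (u i), φ (u i) (u' i), φ (u' i) (b i)], d ∉ FC) ∧
      (∀ i j, i ≠ j → ∀ x ∈ [u i, u' i], x ∉ [u j, u' j]) ∧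
      ∀ i j, i ≠ j → ∀ d ∈ [φ (a i) (u i), φ (u i) (u' i), φ (u' i) (b i)],
        d ∉ [φ (a j) (u j), φ (u j) (u' j), φ (u' j) (b j)] := by
  obtain ⟨f, -, h1, h2⟩ := exists_pairwise_disjoint_choice
    (κ := fun i => {p : Fin n × Fin n // p.1 ≠ p.2 ∧
      [φ (a i) p.1, φ p.1 p.2, φ p.2 (b i)].Nodup})
    (fun i p => [p.1.1, p.1.2].toFinset.disjSum
      [φ (a i) p.1.1, φ p.1.1 p.1.2, φ p.1.2 (b i)].toFinset)
    5 (FV.disjSum FC) (by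
      intro i F hF
      rw [Finset.card_disjSum, ← Finset.card_toLeft_add_card_toRight] at hF
      obtain ⟨u, u', ⟨hu, hu', hne⟩, hnd, hc1, hc2, hc3⟩ :=
        hφ.exists_rainbow_path (a i) (b i) F.toLeft F.toRight (by omega)
      refine ⟨⟨(u, u'), hne, hnd⟩, ?_, ?_⟩
      · rw [Finset.card_disjSum]
        exact Nat.add_le_add (b := 2) (d := 3) (List.toFinset_card_le _) (List.toFinset_card_le _)
      · rw [disjoint_disjSum_left_iff]
        constructor <;> rw [Finset.disjoint_left] <;> simp_all)
  simp only [disjoint_disjSum_left_iff, Finset.toLeft_disjSum, Finset.toRight_disjSum] at h1 h2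
  simp only [Finset.disjoint_left, List.mem_toFinset] at h1 h2
  exact ⟨fun i => (f i).1.1, fun i => (f i).1.2,
    fun i => ⟨(h1 i).1 (by simp), (h1 i).1 (by simp), (f i).2.1⟩, fun i => (f i).2.2,
    fun i _ hd => (h1 i).2 hd, fun i j hij _ hx => (h2 i j hij).1 hx,
    fun i j hij _ hd => (h2 i j hij).2 hd⟩

/-- Copies of the absorber template that are disjoint apart from their prescribed roots, together
with paths linking them in order, form a `T`-absorber. -/
lemma exists_tAbsorber_of_family {α β : Type} [Fintype α] [Fintype β] [DecidableEq α]
    [DecidableEq β] {T : Finset (α × β)} {fV : α → Fin n} {fC : β → Fin n}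
    (hfV : Function.Injective fV) (hfC : Function.Injective fC) (hT : ∀ b, ∃ e ∈ T, e.2 = b)
    (𝓔 : T → AbsorberCopy φ) (hv : ∀ e, (𝓔 e).g 0 = fV e.1.1) (hc : ∀ e, (𝓔 e).k 0 = fC e.1.2)
    (hvert : ∀ e e' s t, (𝓔 e).g s = (𝓔 e').g t → s = 0 ∧ t = 0 ∨ e = e' ∧ s = t)
    (hcol : ∀ e e' s t, (𝓔 e).k s = (𝓔 e').k t → s = 0 ∧ t = 0 ∨ e = e' ∧ s = t)
    (idx : Fin T.card ≃ T) (u u' : Fin (T.card - 1) → Fin n)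
    (a b : Fin (T.card - 1) → Fin n)
    (ha : ∀ i, a i = (𝓔 (idx (Fin.castLE (Nat.sub_le _ _) i))).g 6)
    (hb : ∀ i, b i = (𝓔 (idx ⟨i.1 + 1, Nat.add_lt_of_lt_sub i.2⟩)).g 1)
    (hu : ∀ i e s, u i ≠ (𝓔 e).g s) (hu' : ∀ i e s, u' i ≠ (𝓔 e).g s) (hne : ∀ i, u i ≠ u' i)
    (hnd : ∀ i, [φ (a i) (u i), φ (u i) (u' i), φ (u' i) (b i)].Nodup)
    (hlc : ∀ i, ∀ d ∈ [φ (a i) (u i), φ (u i) (u' i), φ (u' i) (b i)], ∀ e s, d ≠ (𝓔 e).k s)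
    (huu : ∀ i j, i ≠ j → ∀ x ∈ [u i, u' i], x ∉ [u j, u' j])
    (hcc : ∀ i j, i ≠ j → ∀ d ∈ [φ (a i) (u i), φ (u i) (u' i), φ (u' i) (b i)],
      d ∉ [φ (a j) (u j), φ (u j) (u' j), φ (u' j) (b j)]) :
    ∃ (H : Finset (Fin n × Fin n)) (𝔸 : TAbsorber n φ T H), 𝔸.fV = fV ∧ 𝔸.fC = fC := by
  have hua : ∀ i j, u i ≠ a j := fun i j => ha j ▸ hu i _ _
  have hub : ∀ i j, u i ≠ b j := fun i j => hb j ▸ hu i _ _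
  have hua' : ∀ i j, u' i ≠ a j := fun i j => ha j ▸ hu' i _ _
  have hub' : ∀ i j, u' i ≠ b j := fun i j => hb j ▸ hu' i _ _
  have hab : ∀ i j, a i ≠ b j := by
    intro i j h
    rw [ha, hb] at h
    rcases hvert _ _ _ _ h with ⟨h, -⟩ | ⟨-, h⟩ <;> exact absurd h (by decide)
  have haa : ∀ i j, a i = a j → i = j := by
    intro i j h
    rw [ha, ha] at h
    rcases hvert _ _ _ _ h with ⟨h, -⟩ | ⟨h, -⟩
    · exact absurd h (by decide)
    · exact Fin.castLE_injective _ (idx.injective h)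
  have hbb : ∀ i j, b i = b j → i = j := by
    intro i j h
    rw [hb, hb] at h
    rcases hvert _ _ _ _ h with ⟨h, -⟩ | ⟨h, -⟩
    · exact absurd h (by decide)
    · simpa [Fin.ext_iff] using idx.injective h
  let Ab : (e : α × β) → e ∈ T → Absorber n φ (fV e.1) (fC e.2) := fun e he =>
    (𝓔 ⟨e, he⟩).toAbsorber (hv ⟨e, he⟩) (hc ⟨e, he⟩)
  let link : Fin (T.card - 1) → List (Fin n) := fun i => [a i, u i, u' i, b i]
  let L : Finset (Fin n × Fin n) := Finset.univ.biUnion fun i => (pathArcs (link i)).toFinset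
  let H : Finset (Fin n × Fin n) := (T.attach.biUnion fun e => (Ab e.1 e.2).arcs) ∪ L
  have hL : ∀ e ∈ L, ∃ i, e = (a i, u i) ∨ e = (u i, u' i) ∨ e = (u' i, b i) := by
    intro e he
    obtain ⟨i, -, hi⟩ := Finset.mem_biUnion.1 he
    exact ⟨i, by simpa [link, pathArcs] using hi⟩
  have hsub : ∀ e he, (Ab e he).arcs ⊆ H := fun e he x hx =>
    Finset.mem_union_left _ (Finset.mem_biUnion.2 ⟨⟨e, he⟩, Finset.mem_attach _ _, hx⟩)
  have hspread : IsSpreadFamily 𝓔 L := by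
    refine ⟨hvert, hcol, ?_, ?_, ?_, ?_⟩
    · intro e e' h1 h2
      rw [hv, hv] at h1
      rw [hc, hc] at h2
      exact Subtype.ext (Prod.ext (hfV h1) (hfC h2))
    · intro x hx e s h
      obtain ⟨i, rfl | rfl | rfl⟩ := hL x hx
      · rcases hvert _ _ _ _ ((ha i).symm.trans h) with ⟨h, -⟩ | ⟨-, h⟩
        · exact absurd h (by decide)
        · exact h.symm
      · exact absurd h (hu i e s)
      · exact absurd h (hu' i e s)
    · intro x hx e s h
      obtain ⟨i, rfl | rfl | rfl⟩ := hL x hx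
      · exact absurd h (hu i e s)
      · exact absurd h (hu' i e s)
      · rcases hvert _ _ _ _ ((hb i).symm.trans h) with ⟨h, -⟩ | ⟨-, h⟩
        · exact absurd h (by decide)
        · exact h.symm
    · intro x hx e s
      obtain ⟨i, rfl | rfl | rfl⟩ := hL x hx <;> exact hlc i _ (by simp) e s
  have hcovered : IsCoveredBy H 𝓔 L := by
    intro x hx
    refine (Finset.mem_union.1 hx).imp_left fun hx => ?_
    obtain ⟨e, -, he⟩ := Finset.mem_biUnion.1 hx
    exact ⟨e, ((𝓔 e).mem_arcs_toAbsorber (hv e) (hc e) x).1 he⟩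
  have hverts : ∀ e he x, x ∈ (Ab e he).verts → ∃ s, x = (𝓔 ⟨e, he⟩).g s := fun e he x hx =>
    ((𝓔 ⟨e, he⟩).mem_verts_toAbsorber _ _ x).1 hx
  have hcolours : ∀ e he d, d ∈ (Ab e he).colours ↔ ∃ s, d = (𝓔 ⟨e, he⟩).k s := fun e he d =>
    (𝓔 ⟨e, he⟩).mem_colours_toAbsorber _ _ d
  refine ⟨H, {
    fV := fV
    fC := fC
    fVinj := hfV
    fCinj := hfC
    fCrange := ?_
    Ab := Ab
    AbSub := hsub
    AbUnique := fun e he A' hA' => hspread.arcs_eq hcovered (hv ⟨e, he⟩) (hc ⟨e, he⟩) A' hA'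
    AbVertexDisjoint := ?_
    AbColourDisjoint := ?_
    es := fun i => (idx i).1
    esInj := Subtype.val_injective.comp idx.injective
    esMem := fun i => (idx i).2
    link := link
    linkLen := fun i => rfl
    linkNodup := ?_
    linkSub := fun i x hx => Finset.mem_union_right _
      (Finset.mem_biUnion.2 ⟨i, Finset.mem_univ _, List.mem_toFinset.2 hx⟩)
    linkPairwiseDisjoint := ?_
    linkRainbowEach := hnd
    linkRainbowPair := hcc
    linkColourNew := ?_
    linkHead := fun i => congrArg some (ha i)
    linkLast := fun i => congrArg some (hb i)
    linkInternalDisjoint := ?_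
    minimal := rfl }, rfl, rfl⟩
  · intro d
    obtain ⟨e, he, rfl⟩ := hT d
    exact Finset.image_subset_image (hsub e he) ((hcolours e he _).2 ⟨0, (hc ⟨e, he⟩).symm⟩)
  · intro e he e' he' hee x hx hx'
    obtain ⟨s, rfl⟩ := hverts e he x hx
    obtain ⟨t, ht⟩ := hverts e' he' _ hx'
    rcases hvert _ _ _ _ ht with ⟨rfl, rfl⟩ | ⟨h, -⟩
    · rw [hv, hv] at ht
      exact ⟨hfV ht, hv _⟩
    · exact absurd (congrArg Subtype.val h) hee
  · intro e he e' he' hee d hd hd'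
    obtain ⟨s, rfl⟩ := (hcolours e he d).1 hd
    obtain ⟨t, ht⟩ := (hcolours e' he' _).1 hd'
    rcases hcol _ _ _ _ ht with ⟨rfl, rfl⟩ | ⟨h, -⟩
    · rw [hc, hc] at ht
      exact ⟨hfC ht, hc _⟩
    · exact absurd (congrArg Subtype.val h) hee
  · intro i
    simp [link, (hua i i).symm, (hua' i i).symm, hab i i, hne i, hub i i, hub' i i]
  · intro i j hij x hx hx'
    have h1 : a i ≠ a j := fun h => hij (haa _ _ h)
    have h2 : b i ≠ b j := fun h => hij (hbb _ _ h)
    have h3 := huu i j hij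
    simp only [List.mem_cons, List.not_mem_nil, or_false, not_or, forall_eq_or_imp,
      forall_eq] at h3
    simp only [link, List.mem_cons, List.not_mem_nil, or_false] at hx hx'
    rcases hx with rfl | rfl | rfl | rfl
    · simp [h1, hab, (hua j i).symm, (hua' j i).symm] at hx'
    · simp [hua, hub, h3] at hx'
    · simp [hua', hub', h3] at hx'
    · simp [h2, (hab j i).symm, (hub j i).symm, (hub' j i).symm] at hx'
  · intro i d hd e he hde
    obtain ⟨s, hs⟩ := (hcolours e he d).1 hde
    exact hlc i d hd _ s hs
  · intro i x hx e he hxe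
    obtain ⟨s, hs⟩ := hverts e he x hxe
    have hx : x = u i ∨ x = u' i := by simpa [internalVerts, link] using hx
    rcases hx with rfl | rfl
    · exact hu i _ s hs
    · exact hu' i _ s hs

/-- A sparse enough template `T` has a `T`-absorber with any prescribed roots. -/
lemma exists_tAbsorber {α β : Type} [Fintype α] [Fintype β] [DecidableEq α]
    [DecidableEq β] (hφ : IsProper φ) (hA : HasAbsGadgets φ) (hB : HasBridgeGadgets φ)
    {T : Finset (α × β)} {fV : α → Fin n} {fC : β → Fin n}
    (hfV : Function.Injective fV) (hfC : Function.Injective fC) (hT : ∀ b, ∃ e ∈ T, e.2 = b)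
    (h : (Fintype.card α + Fintype.card β + 39 * T.card + 50) * 10 ^ 50 < n) :
    ∃ (H : Finset (Fin n × Fin n)) (𝔸 : TAbsorber n φ T H), 𝔸.fV = fV ∧ 𝔸.fC = fC := by
  have hsmall : (Fintype.card α + Fintype.card β + 39 * T.card + 50) * 4 < n :=
    lt_of_le_of_lt (Nat.mul_le_mul_left _ (by norm_num)) h
  obtain ⟨𝓔, hv, hc, hV, hC, hVd, hCd⟩ := exists_absorberCopy_family hφ hA hB
    (fun e : T => fV e.1.1) (fun e : T => fC e.1.2)
    (Finset.univ.image fV) (Finset.univ.image fC) (by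
      refine lt_of_le_of_lt (Nat.mul_le_mul_right _ ?_) h
      have h1 : (Finset.univ.image fV).card ≤ Fintype.card α := Finset.card_image_le
      have h2 : (Finset.univ.image fC).card ≤ Fintype.card β := Finset.card_image_le
      rw [Fintype.card_coe]
      clear h
      omega)
  clear h
  simp only [Finset.mem_image, Finset.mem_univ, true_and, not_exists] at hV hC
  have hvert : ∀ e e' s t, (𝓔 e).g s = (𝓔 e').g t → s = 0 ∧ t = 0 ∨ e = e' ∧ s = t := by
    intro e e' s t hst
    by_cases hs : s = 0 <;> by_cases ht : t = 0
    · exact Or.inl ⟨hs, ht⟩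
    · rw [hs, hv] at hst
      exact absurd hst (hV e' t ht _)
    · rw [ht, hv] at hst
      exact absurd hst.symm (hV e s hs _)
    · obtain rfl := hVd _ _ _ _ hs ht hst
      exact Or.inr ⟨rfl, (𝓔 e).g_inj hst⟩
  have hcol : ∀ e e' s t, (𝓔 e).k s = (𝓔 e').k t → s = 0 ∧ t = 0 ∨ e = e' ∧ s = t := by
    intro e e' s t hst
    by_cases hs : s = 0 <;> by_cases ht : t = 0
    · exact Or.inl ⟨hs, ht⟩
    · rw [hs, hc] at hst
      exact absurd hst (hC e' t ht _)
    · rw [ht, hc] at hst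
      exact absurd hst.symm (hC e s hs _)
    · obtain rfl := hCd _ _ _ _ hs ht hst
      exact Or.inr ⟨rfl, (𝓔 e).k_inj hst⟩
  let FV : Finset (Fin n) := Finset.univ.biUnion fun e => Finset.univ.image (𝓔 e).g
  let FC : Finset (Fin n) := Finset.univ.biUnion fun e => Finset.univ.image (𝓔 e).k
  have hFV : FV.card ≤ T.card * 21 := by
    rw [← Fintype.card_coe T]
    exact Finset.card_biUnion_le_card_mul _ _ _ fun e _ => Finset.card_image_le
  have hFC : FC.card ≤ T.card * 20 := by
    rw [← Fintype.card_coe T]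
    exact Finset.card_biUnion_le_card_mul _ _ _ fun e _ => Finset.card_image_le
  have hnV : ∀ x, x ∉ FV → ∀ e s, x ≠ (𝓔 e).g s := by
    rintro x hx e s rfl
    exact hx (Finset.mem_biUnion.2 ⟨e, Finset.mem_univ _, Finset.mem_image_of_mem _
      (Finset.mem_univ _)⟩)
  have hnC : ∀ d, d ∉ FC → ∀ e s, d ≠ (𝓔 e).k s := by
    rintro d hd e s rfl
    exact hd (Finset.mem_biUnion.2 ⟨e, Finset.mem_univ _, Finset.mem_image_of_mem _
      (Finset.mem_univ _)⟩)
  let idx : Fin T.card ≃ T := T.equivFin.symm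
  obtain ⟨u, u', h1, h2, h3, h4, h5⟩ := exists_link_family hφ
    (fun i => (𝓔 (idx (Fin.castLE (Nat.sub_le _ 1) i))).g 6)
    (fun i => (𝓔 (idx ⟨i.1 + 1, Nat.add_lt_of_lt_sub i.2⟩)).g 1) FV FC (by
      rw [Fintype.card_fin]
      omega)
  exact exists_tAbsorber_of_family hfV hfC hT 𝓔 hv hc hvert hcol idx u u' _ _ (fun _ => rfl)
    (fun _ => rfl) (fun i => hnV _ (h1 i).1) (fun i => hnV _ (h1 i).2.1) (fun i => (h1 i).2.2) h2
    (fun i d hd => hnC d (h3 i d hd)) h4 h5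

end Assembly
/-- Given the well-spread gadget collections, `G` contains a
`T`-absorber rooted on `U` and `D` whose flexible root vertices and colours are `V'` and
`C'`, for any `256`-regular `2RMBG(7m, 2m)` template `T` with `m < n / log n`. -/
theorem statement_16 :
    ∃ n₀ : ℕ, ∀ n : ℕ, n₀ ≤ n → ∀ G : Colouring n, ∀ m : ℕ,
      (m : ℝ) < n / Real.log n →
      ∀ (α β : Type) [Fintype α] [Fintype β] [DecidableEq α] [DecidableEq β],
      ∀ T : Finset (α × β),
        Fintype.card α = 7 * m → Fintype.card β = 7 * m →
        (∀ a : α, (T.filter fun e => e.1 = a).card = 256) →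
        (∀ b : β, (T.filter fun e => e.2 = b).card = 256) →
        ∀ A' : Finset α, ∀ B' : Finset β, A'.card = 2 * m → B'.card = 2 * m →
        RobustlyMatchable T A' B' →
        ∀ U D : Finset (Fin n), U.card = 7 * m → D.card = 7 * m →
        ∀ V' C' : Finset (Fin n), V' ⊆ U → C' ⊆ D → V'.card = 2 * m → C'.card = 2 * m →
        HasAbsGadgets G.1 → HasBridgeGadgets G.1 →
        ∃ (H : Finset (Fin n × Fin n)) (𝔸 : TAbsorber n G.1 T H),
          Finset.image 𝔸.fV Finset.univ = U ∧
          Finset.image 𝔸.fC Finset.univ = D ∧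
          Finset.image 𝔸.fV A' = V' ∧
          Finset.image 𝔸.fC B' = C' := by
  obtain ⟨n₀, hn₀⟩ := eventually_template_size_lt
  refine ⟨n₀, ?_⟩
  intro n hn G m hm α β _ _ _ _ T hα hβ hTα hTβ A' B' hA' hB' _ U D hU hD V' C' hV'U hC'D hV' hC'
    hA hB
  have hsize := hn₀ n hn m hm
  have : Nonempty (Fin n) := ⟨⟨0, Nat.zero_lt_of_lt hsize⟩⟩
  have hT : T.card = 7 * m * 256 := by
    rw [Finset.card_eq_sum_card_fiberwise (f := Prod.fst) (t := Finset.univ) fun _ _ => by simp,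
      Finset.sum_congr rfl fun a _ => hTα a]
    simp [hα]
  obtain ⟨fV, hfV, hfU, hfV'⟩ :=
    exists_injective_image_eq hV'U (hα.trans hU.symm) (hA'.trans hV'.symm)
  obtain ⟨fC, hfC, hfD, hfC'⟩ :=
    exists_injective_image_eq hC'D (hβ.trans hD.symm) (hB'.trans hC'.symm)
  have hdeg : ∀ b, ∃ e ∈ T, e.2 = b := by
    intro b
    obtain ⟨e, he⟩ := Finset.card_pos.1 (by rw [hTβ b]; norm_num)
    exact ⟨e, Finset.mem_filter.1 he⟩
  obtain ⟨H, 𝔸, h1, h2⟩ := exists_tAbsorber G.2 hA hB hfV hfC hdeg (by rwa [hα, hβ, hT])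
  refine ⟨H, 𝔸, ?_, ?_, ?_, ?_⟩
  · rw [h1]; convert hfU
  · rw [h2]; convert hfD
  · rw [h1]; convert hfV'
  · rw [h2]; convert hfC'

end RandomLatin
end
end

section
/- There exists n₀ such that the following holds for all n ≥ n₀. Let G ∈ Φ(K_n^↔) with colouring φ be such that for every colour c ∈ [n], at most n/2 loops of G have colour c, and let m := ⌊n/(log n)³⌋. Then there exist sets V' ⊆ [n] and C' ⊆ [n] with |V'| = |C'| = 2m such that for all distinct u, v ∈ [n] and every colour c ∈ [n], there are at least n^{99/50} rainbow directed paths P of length four in G with tail u and head v whose second arc has colour c, whose internal vertices all lie in V', and all of whose colours other than c lie in C'. -/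
open scoped Classical

noncomputable section

namespace RandomLatin

/-- Among the maps `X → Fin q`, the proportion of those not constantly `k` on any of the
pairwise disjoint sets `e i`, `i ∈ M`, of size at most `s`, is at most `(1 - q⁻ˢ) ^ |M|`. -/
theorem pow_mul_card_avoiding_le {X ι : Type*} [Fintype X] {q s : ℕ} (k : Fin q)
    (e : ι → Finset X) (M : Finset ι) (hs : ∀ i ∈ M, (e i).card ≤ s)
    (hM : (M : Set ι).PairwiseDisjoint e) :
    (q ^ s) ^ M.card *
        (Finset.univ.filter fun g : X → Fin q => ∀ i ∈ M, ∃ x ∈ e i, g x ≠ k).card ≤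
      (q ^ s - 1) ^ M.card * q ^ Fintype.card X := by
  have hq : 0 < q := k.pos
  induction M using Finset.induction_on with
  | empty => simp
  | insert a M ha ih =>
    have ih := ih (fun i hi => hs i (Finset.mem_insert_of_mem hi))
      (hM.subset (by simp))
    have hdisj : ∀ i ∈ M, Disjoint (e i) (e a) := fun i hi =>
      hM (by simp [hi]) (by simp) (fun h => ha (h ▸ hi))
    set A := Finset.univ.filter fun g : X → Fin q => ∀ i ∈ M, ∃ x ∈ e i, g x ≠ k with hA
    have hsplit := Finset.card_filter_add_card_filter_not (s := A)
      (fun g : X → Fin q => ∃ x ∈ e a, g x ≠ k)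
    have hB : (Finset.univ.filter
        fun g : X → Fin q => ∀ i ∈ insert a M, ∃ x ∈ e i, g x ≠ k) =
        A.filter fun g : X → Fin q => ∃ x ∈ e a, g x ≠ k := by
      ext g
      simp [hA, and_comm]
    rw [hB, Finset.card_insert_of_notMem ha]
    set B := A.filter fun g : X → Fin q => ∃ x ∈ e a, g x ≠ k
    set C := A.filter fun g : X → Fin q => ¬ ∃ x ∈ e a, g x ≠ k with hC
    have hAC : A.card ≤ C.card * q ^ s := by
      calc A.card ≤ (C ×ˢ (Finset.univ : Finset ({x // x ∈ e a} → Fin q))).card := by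
            refine Finset.card_le_card_of_injOn
              (fun g => (fun x => if x ∈ e a then k else g x, fun x => g x)) ?_ ?_
            · intro g hg
              simp only [hA, Finset.coe_filter, Finset.mem_univ, true_and,
                Set.mem_ofPred_eq] at hg
              simp only [hC, hA, Finset.coe_product, Set.mem_prod, Finset.mem_coe,
                Finset.mem_filter, Finset.mem_univ, true_and, and_true]
              refine ⟨fun i hi => ?_, ?_⟩
              · obtain ⟨x, hx, hxk⟩ := hg i hi
                refine ⟨x, hx, ?_⟩
                rwa [if_neg (Finset.disjoint_left.1 (hdisj i hi) hx)]
              · rintro ⟨x, hx, hxk⟩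
                simp [hx] at hxk
            · intro g _ g' _ h
              simp only [Prod.mk.injEq] at h
              funext x
              by_cases hx : x ∈ e a
              · exact congrFun h.2 ⟨x, hx⟩
              · simpa [hx] using congrFun h.1 x
        _ = C.card * q ^ (e a).card := by simp
        _ ≤ C.card * q ^ s := by
            gcongr
            exact hs a (by simp)
    have hBA : q ^ s * B.card ≤ (q ^ s - 1) * A.card := by
      rw [Nat.sub_mul, one_mul]
      refine Nat.le_sub_of_add_le ?_
      calc q ^ s * B.card + A.card ≤ q ^ s * B.card + C.card * q ^ s := by gcongr
        _ = q ^ s * A.card := by rw [← hsplit]; ring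
    calc (q ^ s) ^ (M.card + 1) * B.card = (q ^ s) ^ M.card * (q ^ s * B.card) := by ring
      _ ≤ (q ^ s) ^ M.card * ((q ^ s - 1) * A.card) := by gcongr
      _ = (q ^ s - 1) * ((q ^ s) ^ M.card * A.card) := by ring
      _ ≤ (q ^ s - 1) * ((q ^ s - 1) ^ M.card * q ^ Fintype.card X) := by gcongr
      _ = _ := by ring

/-- A set of density at most `1 / q` containing an edge of each of several large matchings. -/
theorem exists_small_set_hitting_matchings {X κ ι : Type*} [Fintype X] [Fintype κ]
    {q s T : ℕ} (hq : 0 < q) (e : κ → ι → Finset X) (M : κ → Finset ι)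
    (hs : ∀ j, ∀ i ∈ M j, (e j i).card ≤ s)
    (hM : ∀ j, (M j : Set ι).PairwiseDisjoint (e j)) (hT : ∀ j, (M j).card = T)
    (hlt : Fintype.card κ * q * (q ^ s - 1) ^ T < (q ^ s) ^ T) :
    ∃ S : Finset X, q * S.card ≤ Fintype.card X ∧ ∀ j, ∃ i ∈ M j, e j i ⊆ S := by
  obtain ⟨g, hg⟩ : ∃ g : X → Fin q, ∀ j k, ∃ i ∈ M j, ∀ x ∈ e j i, g x = k := by
    by_contra! hbad
    let A : κ × Fin q → Finset (X → Fin q) := fun p =>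
      Finset.univ.filter fun g => ∀ i ∈ M p.1, ∃ x ∈ e p.1 i, g x ≠ p.2
    have hcover : (Finset.univ : Finset (X → Fin q)) ⊆ Finset.univ.biUnion A := by
      intro g _
      obtain ⟨j, k, h⟩ := hbad g
      exact Finset.mem_biUnion.2 ⟨(j, k), Finset.mem_univ _, by simpa [A] using h⟩
    have hcard : q ^ Fintype.card X ≤ ∑ p, (A p).card := by
      simpa using (Finset.card_le_card hcover).trans Finset.card_biUnion_le
    have hpos : 0 < q ^ Fintype.card X := by positivity
    have : (q ^ s) ^ T * q ^ Fintype.card X ≤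
        (Fintype.card κ * q * (q ^ s - 1) ^ T) * q ^ Fintype.card X :=
      calc (q ^ s) ^ T * q ^ Fintype.card X ≤ (q ^ s) ^ T * ∑ p, (A p).card := by gcongr
        _ = ∑ p, (q ^ s) ^ T * (A p).card := Finset.mul_sum _ _ _
        _ ≤ ∑ _p : κ × Fin q, (q ^ s - 1) ^ T * q ^ Fintype.card X := by
            refine Finset.sum_le_sum fun p _ => ?_
            have := pow_mul_card_avoiding_le p.2 (e p.1) (M p.1) (hs p.1) (hM p.1)
            rwa [hT] at this
        _ = _ := by simp; ring
    exact absurd (Nat.le_of_mul_le_mul_right this hpos) (not_le.2 hlt)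
  obtain ⟨k, hk⟩ : ∃ k : Fin q, q * (Finset.univ.filter fun x => g x = k).card ≤
      Fintype.card X := by
    by_contra! h
    have hsum : Fintype.card X = ∑ k : Fin q, (Finset.univ.filter fun x => g x = k).card :=
      Finset.card_eq_sum_card_fiberwise (by simp)
    have : ∑ _k : Fin q, Fintype.card X <
        ∑ k : Fin q, q * (Finset.univ.filter fun x => g x = k).card :=
      Finset.sum_lt_sum_of_nonempty ⟨⟨0, hq⟩, Finset.mem_univ _⟩ fun k _ => h k
    rw [← Finset.mul_sum, ← hsum] at this
    simp at this
  refine ⟨_, hk, fun j => ?_⟩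
  obtain ⟨i, hi, hx⟩ := hg j k
  exact ⟨i, hi, fun x hxe => by simpa using hx x hxe⟩

/-- A hypergraph of bounded degree with many edges has a matching of size `T`. -/
theorem exists_matching {X ι : Type*} [DecidableEq X] {s D : ℕ} (e : ι → Finset X) (E : Finset ι)
    (hne : ∀ i ∈ E, (e i).Nonempty) (hs : ∀ i ∈ E, (e i).card ≤ s)
    (hD : ∀ x, (E.filter fun i => x ∈ e i).card ≤ D) (T : ℕ) (hT : T * (s * D) < E.card) :
    ∃ M ⊆ E, M.card = T ∧ (M : Set ι).PairwiseDisjoint e := by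
  induction T with
  | zero => exact ⟨∅, by simp⟩
  | succ T ih =>
    have hlt : T * (s * D) < E.card := lt_of_le_of_lt (by gcongr; omega) hT
    obtain ⟨M, hME, hMT, hM⟩ := ih hlt
    let U := (M.biUnion e).biUnion fun x => E.filter fun i => x ∈ e i
    have hU : U.card ≤ T * (s * D) := by
      calc U.card ≤ (M.biUnion e).card * D := Finset.card_biUnion_le_card_mul _ _ _ fun x _ => hD x
        _ ≤ (M.card * s) * D := by
            gcongr
            exact Finset.card_biUnion_le_card_mul _ _ _ fun i hi => hs i (hME hi)
        _ = T * (s * D) := by rw [hMT, mul_assoc]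
    obtain ⟨a, haE, haU⟩ := Finset.exists_mem_notMem_of_card_lt_card (hU.trans_lt hlt)
    have hdisj : ∀ i ∈ M, Disjoint (e a) (e i) := fun i hi =>
      Finset.disjoint_left.2 fun x hxa hxi => haU <| Finset.mem_biUnion.2
        ⟨x, Finset.mem_biUnion.2 ⟨i, hi, hxi⟩, Finset.mem_filter.2 ⟨haE, hxa⟩⟩
    have haM : a ∉ M := fun h =>
      (hne a haE).ne_empty (disjoint_self.1 (hdisj a h))
    refine ⟨insert a M, Finset.insert_subset haE hME, by simp [haM, hMT], ?_⟩
    rw [Finset.coe_insert]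
    exact hM.insert fun i hi _ => hdisj i hi

/-- A hypergraph of bounded degree with many edges has `r` disjoint matchings of size `T`. -/
theorem exists_disjoint_matchings {X ι : Type*} [DecidableEq X] {s D T : ℕ}
    (e : ι → Finset X) (r : ℕ) (E : Finset ι) (hne : ∀ i ∈ E, (e i).Nonempty)
    (hs : ∀ i ∈ E, (e i).card ≤ s)
    (hD : ∀ x, (E.filter fun i => x ∈ e i).card ≤ D) (hT : r * T + T * (s * D) < E.card) :
    ∃ M : Fin r → Finset ι, (∀ j, M j ⊆ E ∧ (M j).card = T ∧
      (M j : Set ι).PairwiseDisjoint e) ∧ Pairwise fun j j' => Disjoint (M j) (M j') := by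
  induction r generalizing E with
  | zero => exact ⟨fun _ => ∅, fun j => j.elim0, fun j => j.elim0⟩
  | succ r ih =>
    obtain ⟨M₀, hM₀, hcard, hdisj⟩ :=
      exists_matching e E hne hs hD T (lt_of_le_of_lt (Nat.le_add_left _ _) hT)
    obtain ⟨M, hM, hMM⟩ := ih (E \ M₀) (fun i hi => hne i (Finset.sdiff_subset hi))
      (fun i hi => hs i (Finset.sdiff_subset hi))
      (fun x => (Finset.card_le_card
        (Finset.filter_subset_filter _ Finset.sdiff_subset)).trans (hD x))
      (by rw [Finset.card_sdiff_of_subset hM₀, hcard]; rw [add_mul] at hT; omega)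
    have h0 : ∀ j, Disjoint M₀ (M j) := fun j =>
      Finset.disjoint_of_subset_right (hM j).1 Finset.disjoint_sdiff
    refine ⟨Fin.cons M₀ M, fun j => ?_, fun j j' hjj' => ?_⟩
    · cases j using Fin.cases with
      | zero => exact ⟨hM₀, hcard, hdisj⟩
      | succ j => exact ⟨(hM j).1.trans Finset.sdiff_subset, (hM j).2⟩
    · cases j using Fin.cases with
      | zero =>
        cases j' using Fin.cases with
        | zero => exact absurd rfl hjj'
        | succ j' => exact h0 j'
      | succ j =>
        cases j' using Fin.cases with
        | zero => exact (h0 j).symm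
        | succ j' => exact hMM fun h => hjj' (congrArg _ h)

/-- Finitely many dense hypergraphs of bounded degree on the same vertex set all have many
edges inside a common set of density at most `1 / q`. -/
theorem exists_small_set_inducing_many_edges {X κ ι : Type*} [Fintype X] [DecidableEq X]
    [Fintype κ]
    {q s D T r : ℕ} (hq : 0 < q) (e : κ → ι → Finset X) (E : κ → Finset ι)
    (hne : ∀ j, ∀ i ∈ E j, (e j i).Nonempty) (hs : ∀ j, ∀ i ∈ E j, (e j i).card ≤ s)
    (hD : ∀ j x, ((E j).filter fun i => x ∈ e j i).card ≤ D)
    (hE : ∀ j, r * T + T * (s * D) < (E j).card)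
    (hlt : Fintype.card κ * r * q * (q ^ s - 1) ^ T < (q ^ s) ^ T) :
    ∃ S : Finset X, q * S.card ≤ Fintype.card X ∧
      ∀ j, r ≤ ((E j).filter fun i => e j i ⊆ S).card := by
  choose M hM hMM using fun j => exists_disjoint_matchings (e j) r (E j) (hne j) (hs j) (hD j) (hE j)
  obtain ⟨S, hS, hhit⟩ := exists_small_set_hitting_matchings (κ := κ × Fin r) hq
    (fun p => e p.1) (fun p => M p.1 p.2) (fun p i hi => hs p.1 i ((hM p.1 p.2).1 hi))
    (fun p => (hM p.1 p.2).2.2) (fun p => (hM p.1 p.2).2.1) (by simpa using hlt)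
  refine ⟨S, hS, fun j => ?_⟩
  choose f hfM hfS using fun k => hhit (j, k)
  have hinj : Function.Injective f := fun k k' h => by
    by_contra hne
    exact Finset.disjoint_left.1 (hMM j hne) (hfM k) (h ▸ hfM k')
  calc r = (Finset.univ.image f).card := by simp [Finset.card_image_of_injective _ hinj]
    _ ≤ _ := Finset.card_le_card fun i hi => by
      obtain ⟨k, -, rfl⟩ := Finset.mem_image.1 hi
      exact Finset.mem_filter.2 ⟨(hM j k).1 (hfM k), hfS k⟩

section Parameters

open Filter Asymptotics

/-- For large `n` there are parameters satisfying all the numerical constraints needed to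
select a random set of density `1 / q`. -/
theorem eventually_exists_parameters : ∀ᶠ n : ℕ in atTop, ∃ q T r : ℕ, 0 < q ∧
    (n : ℝ) ^ (99 / 50 : ℝ) ≤ r ∧
    2 * (r * T + T * (6 * (6 * n)) + 14 * n) < n * n ∧
    n * n * n * r * q * (q ^ 6 - 1) ^ T < (q ^ 6) ^ T ∧
    n ≤ q * ⌊(n : ℝ) / Real.log n ^ 3⌋₊ ∧ 2 * ⌊(n : ℝ) / Real.log n ^ 3⌋₊ ≤ n := by
  have hx : Tendsto (fun n : ℕ => (n : ℝ) ^ (1 / 1000 : ℝ)) atTop atTop :=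
    (tendsto_rpow_atTop (by norm_num)).comp tendsto_natCast_atTop_atTop
  have hlog : ∀ᶠ x : ℝ in atTop, 2 * (1000 * Real.log x) ^ 3 ≤ x := by
    have h := (Real.isLittleO_pow_log_id_atTop (n := 3)).def
      (show (0 : ℝ) < 1 / (2 * 1000 ^ 3) by norm_num)
    filter_upwards [h, eventually_ge_atTop 1] with x hx h1
    have h0 : 0 ≤ Real.log x := Real.log_nonneg h1
    simp only [id, Real.norm_eq_abs, abs_of_nonneg (pow_nonneg h0 3),
      abs_of_nonneg (zero_le_one.trans h1)] at hx
    rw [mul_pow]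
    linarith
  have hexp : ∀ᶠ x : ℝ in atTop, 4 * x ^ 4981 < Real.exp (1 / 64 * x) := by
    have h := (isLittleO_pow_exp_pos_mul_atTop 4981 (show (0 : ℝ) < 1 / 64 by norm_num)).def
      (show (0 : ℝ) < 1 / 5 by norm_num)
    filter_upwards [h, eventually_ge_atTop 1] with x hx h1
    rw [Real.norm_of_nonneg (by positivity), Real.norm_of_nonneg (by positivity)] at hx
    have := Real.exp_pos (1 / 64 * x)
    linarith
  filter_upwards [hx.eventually hlog, hx.eventually hexp,
    hx.eventually (eventually_ge_atTop 3), eventually_ge_atTop 1] with n hlog hexp hx3 hn1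
  set x : ℝ := (n : ℝ) ^ (1 / 1000 : ℝ) with hxdef
  have hn0 : (0 : ℝ) ≤ n := n.cast_nonneg
  have hnx : (n : ℝ) = x ^ 1000 := by
    rw [hxdef, ← Real.rpow_natCast, ← Real.rpow_mul hn0]
    norm_num
  have hnr : (n : ℝ) ^ (99 / 50 : ℝ) = x ^ 1980 := by
    rw [hxdef, ← Real.rpow_natCast, ← Real.rpow_mul hn0]
    norm_num
  have hlogn : Real.log n = 1000 * Real.log x := by
    rw [hnx, Real.log_pow]; norm_num
  have hx1 : 1 ≤ x := by linarith
  have ceil_le : ∀ y : ℝ, 1 ≤ y → (⌈y⌉₊ : ℝ) ≤ 2 * y := fun y hy => by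
    have := (Nat.ceil_lt_add_one (zero_le_one.trans hy)).le
    linarith
  have hq := ceil_le x hx1
  have hT := ceil_le (x ^ 10) (one_le_pow₀ hx1)
  have hr := ceil_le (x ^ 1980) (one_le_pow₀ hx1)
  have hq' := Nat.le_ceil x
  have hT' := Nat.le_ceil (x ^ 10)
  have hr' := Nat.le_ceil (x ^ 1980)
  set q := ⌈x⌉₊
  set T := ⌈x ^ 10⌉₊
  set r := ⌈x ^ 1980⌉₊
  have hqpos : 0 < q := Nat.ceil_pos.2 (by linarith)
  have hlogx : 1 ≤ Real.log x := by
    rw [Real.le_log_iff_exp_le (by linarith)]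
    linarith [Real.exp_one_lt_three]
  have hL : 2 ≤ Real.log n ^ 3 := by
    rw [hlogn]
    nlinarith [one_le_pow₀ hlogx (n := 3), mul_pow 1000 (Real.log x) 3]
  rw [← hlogn] at hlog
  refine ⟨q, T, r, hqpos, hnr ▸ hr', ?_, ?_, ?_, ?_⟩
  · have h1 : (r : ℝ) * T ≤ 2 * x ^ 1980 * (2 * x ^ 10) := by gcongr
    have h2 : (T : ℝ) * (6 * (6 * n)) ≤ 2 * x ^ 10 * (6 * (6 * x ^ 1000)) := by
      rw [hnx]; gcongr
    have h3 : x ^ 1010 ≤ x ^ 1990 := pow_le_pow_right₀ hx1 (by norm_num)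
    have h4 : x ^ 1000 ≤ x ^ 1990 := pow_le_pow_right₀ hx1 (by norm_num)
    have h5 : (0 : ℝ) < x ^ 1990 := by positivity
    have h6 : (3 : ℝ) ^ 10 ≤ x ^ 10 := by gcongr
    have h7 : (3 : ℝ) ^ 10 * x ^ 1990 ≤ x ^ 10 * x ^ 1990 := by gcongr
    have h8 : (n : ℝ) * n = x ^ 10 * x ^ 1990 := by
      rw [hnx, ← pow_add, ← pow_add]
    have h9 : 2 * x ^ 1980 * (2 * x ^ 10) = 4 * x ^ 1990 := by ring
    have h10 : 2 * x ^ 10 * (6 * (6 * x ^ 1000)) = 72 * x ^ 1010 := by ring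
    have : (2 * (r * T + T * (6 * (6 * n)) + 14 * n) : ℝ) < n * n := by
      rw [h8]
      norm_num at h7
      linarith
    exact_mod_cast this
  · have hq0 : (0 : ℝ) < q := by exact_mod_cast hqpos
    have hsub : ((q ^ 6 - 1 : ℕ) : ℝ) = (q : ℝ) ^ 6 * (1 - 1 / (q : ℝ) ^ 6) := by
      rw [Nat.cast_sub (Nat.one_le_pow _ _ hqpos)]
      push_cast
      field_simp
    have hsmall : (1 - 1 / (q : ℝ) ^ 6) ^ T ≤ Real.exp (-(1 / 64 * x)) := by
      have hle : 1 - 1 / (q : ℝ) ^ 6 ≤ Real.exp (-(1 / (q : ℝ) ^ 6)) := by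
        linarith [Real.add_one_le_exp (-(1 / (q : ℝ) ^ 6))]
      have hnn : 0 ≤ 1 - 1 / (q : ℝ) ^ 6 := by
        rw [sub_nonneg, div_le_one (by positivity)]
        exact one_le_pow₀ (by linarith)
      calc (1 - 1 / (q : ℝ) ^ 6) ^ T ≤ Real.exp (-(1 / (q : ℝ) ^ 6)) ^ T := by gcongr
        _ = Real.exp (T * -(1 / (q : ℝ) ^ 6)) := (Real.exp_nat_mul _ _).symm
        _ ≤ _ := by
          rw [Real.exp_le_exp, mul_neg, neg_le_neg_iff, mul_one_div, le_div_iff₀ (by positivity)]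
          calc 1 / 64 * x * (q : ℝ) ^ 6 ≤ 1 / 64 * x * (2 * x) ^ 6 := by gcongr
            _ = x ^ 7 := by ring
            _ ≤ x ^ 10 := pow_le_pow_right₀ hx1 (by norm_num)
            _ ≤ T := hT'
    have hmul : (n * n * n * r * q : ℝ) * Real.exp (-(1 / 64 * x)) < 1 := by
      have : (n * n * n * r * q : ℝ) ≤ 4 * x ^ 4981 :=
        calc (n * n * n * r * q : ℝ) ≤ x ^ 1000 * x ^ 1000 * x ^ 1000 * (2 * x ^ 1980) * (2 * x) := by
              rw [hnx]; gcongr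
          _ = 4 * x ^ 4981 := by ring
      rw [Real.exp_neg, ← div_eq_mul_inv, div_lt_one (Real.exp_pos _)]
      exact this.trans_lt hexp
    have : (n * n * n * r * q * ((q ^ 6 - 1 : ℕ) : ℝ) ^ T : ℝ) < ((q : ℝ) ^ 6) ^ T := by
      rw [hsub, mul_pow]
      calc (n * n * n * r * q * (((q : ℝ) ^ 6) ^ T * (1 - 1 / (q : ℝ) ^ 6) ^ T) : ℝ)
          = (n * n * n * r * q : ℝ) * (1 - 1 / (q : ℝ) ^ 6) ^ T * ((q : ℝ) ^ 6) ^ T := by ring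
        _ ≤ (n * n * n * r * q : ℝ) * Real.exp (-(1 / 64 * x)) * ((q : ℝ) ^ 6) ^ T := by gcongr
        _ < 1 * ((q : ℝ) ^ 6) ^ T := by gcongr
        _ = _ := one_mul _
    exact_mod_cast this
  · have hm := Nat.lt_floor_add_one ((n : ℝ) / Real.log n ^ 3)
    set m := ⌊(n : ℝ) / Real.log n ^ 3⌋₊
    have hxn : x ≤ n := by
      rw [hnx]; exact le_self_pow₀ hx1 (by norm_num)
    have h1 : 2 * (n : ℝ) ≤ x * (n / Real.log n ^ 3) := by
      rw [mul_div_assoc', le_div_iff₀ (by linarith)]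
      nlinarith
    have h2 : (n : ℝ) ≤ x * m := by nlinarith
    have h3 : x * m ≤ q * m := by gcongr
    exact_mod_cast h2.trans h3
  · have h1 : (⌊(n : ℝ) / Real.log n ^ 3⌋₊ : ℝ) ≤ n / Real.log n ^ 3 := Nat.floor_le (by positivity)
    have h2 : (n : ℝ) / Real.log n ^ 3 ≤ n / 2 := by gcongr
    have : (2 * ⌊(n : ℝ) / Real.log n ^ 3⌋₊ : ℝ) ≤ n := by linarith
    exact_mod_cast this

end Parameters

theorem card_filter_le_of_injOn {α β : Type*} [Fintype α] [Fintype β] {P : α → Prop}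
    [DecidablePred P] (g : α → β)
    (h : ∀ a a', P a → P a' → g a = g a' → a = a') :
    (Finset.univ.filter P).card ≤ Fintype.card β :=
  Finset.card_le_card_of_injOn g (by simp) fun a ha a' ha' =>
    h a a' (by simpa using ha) (by simpa using ha')

theorem card_filter_or_le_add {α : Type*} [Fintype α] {P Q : α → Prop}
    [DecidablePred P] [DecidablePred Q] [DecidablePred fun x => P x ∨ Q x] {a b : ℕ}
    (hP : (Finset.univ.filter P).card ≤ a) (hQ : (Finset.univ.filter Q).card ≤ b) :
    (Finset.univ.filter fun x => P x ∨ Q x).card ≤ a + b := by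
  have h : (Finset.univ.filter fun x => P x ∨ Q x) =
      Finset.univ.filter P ∪ Finset.univ.filter Q := by ext; simp
  rw [h]
  exact (Finset.card_union_le _ _).trans (add_le_add hP hQ)

/-- The pairs `(w₁, w₃)` for which `u → w₁ → f w₁ → w₃ → v` is a rainbow path, where `f w` is
the head of the arc of a given colour with tail `w`. -/
def rainbowPairs {n : ℕ} (φ : Fin n → Fin n → Fin n) (f : Fin n → Fin n) (u v : Fin n) :
    Finset (Fin n × Fin n) :=
  Finset.univ.filter fun p => ([u, p.1, f p.1, p.2, v] : List (Fin n)).Nodup ∧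
    ([φ u p.1, φ p.1 (f p.1), φ (f p.1) p.2, φ p.2 v] : List (Fin n)).Nodup

/-- The internal vertices and the colours other than the second one of the path
`u → w₁ → f w₁ → w₃ → v`. -/
def pathSupport {n : ℕ} (φ : Fin n → Fin n → Fin n) (f : Fin n → Fin n) (u v : Fin n)
    (p : Fin n × Fin n) : Finset (Fin n ⊕ Fin n) :=
  {.inl p.1, .inl (f p.1), .inl p.2, .inr (φ u p.1), .inr (φ (f p.1) p.2), .inr (φ p.2 v)}

theorem pathSupport_nonempty {n : ℕ} (φ : Fin n → Fin n → Fin n) (f : Fin n → Fin n)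
    (u v : Fin n) (p : Fin n × Fin n) : (pathSupport φ f u v p).Nonempty :=
  Finset.insert_nonempty _ _

theorem card_pathSupport_le {n : ℕ} (φ : Fin n → Fin n → Fin n) (f : Fin n → Fin n)
    (u v : Fin n) (p : Fin n × Fin n) : (pathSupport φ f u v p).card ≤ 6 :=
  Finset.card_le_six

theorem IsProper.injective_of_colour_eq {n : ℕ} {φ : Fin n → Fin n → Fin n} (hφ : IsProper φ)
    {c : Fin n} {f : Fin n → Fin n} (hf : ∀ w, φ w (f w) = c) : Function.Injective f :=
  fun a b h => hφ.2 a b (f a) (by rw [hf a, h, hf b])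

theorem IsProper.card_filter_mem_pathSupport_le {n : ℕ} {φ : Fin n → Fin n → Fin n}
    (hφ : IsProper φ) {f : Fin n → Fin n} (hf : Function.Injective f) (u v : Fin n)
    (x : Fin n ⊕ Fin n) :
    (Finset.univ.filter fun p => x ∈ pathSupport φ f u v p).card ≤ 6 * n := by
  simp only [pathSupport, Finset.mem_insert, Finset.mem_singleton]
  have key : ∀ {P : Fin n × Fin n → Prop} [DecidablePred P] (g : Fin n × Fin n → Fin n),
      (∀ a a', P a → P a' → g a = g a' → a = a') → (Finset.univ.filter P).card ≤ n :=
    fun {_} _ g h => (card_filter_le_of_injOn g h).trans_eq (Fintype.card_fin n)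
  have h := card_filter_or_le_add (key (P := fun p => x = .inl p.1) Prod.snd ?_) <|
    card_filter_or_le_add (key (P := fun p => x = .inl (f p.1)) Prod.snd ?_) <|
    card_filter_or_le_add (key (P := fun p => x = .inl p.2) Prod.fst ?_) <|
    card_filter_or_le_add (key (P := fun p => x = .inr (φ u p.1)) Prod.snd ?_) <|
    card_filter_or_le_add (key (P := fun p => x = .inr (φ (f p.1) p.2)) Prod.fst ?_)
      (key (P := fun p => x = .inr (φ p.2 v)) Prod.fst ?_)
  · exact h.trans_eq (by ring)
  all_goals
    rintro ⟨a, b⟩ ⟨a', b'⟩ rfl h2 h3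
    simp only [Sum.inl.injEq, Sum.inr.injEq] at h2 h3
    subst h3
  · rw [h2]
  · rw [hf h2]
  · rw [h2]
  · rw [hφ.1 _ _ _ h2]
  · rw [hφ.1 _ _ _ h2]
  · rw [hφ.2 _ _ _ h2]

theorem IsProper.mul_self_le_card_rainbowPairs {n : ℕ} {φ : Fin n → Fin n → Fin n}
    (hφ : IsProper φ) {c : Fin n} {f : Fin n → Fin n} (hf : ∀ w, φ w (f w) = c)
    (hloop : 2 * loopCount φ c ≤ n) {u v : Fin n} (huv : u ≠ v) :
    n * n ≤ 2 * ((rainbowPairs φ f u v).card + 14 * n) := by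
  have hinj := hφ.injective_of_colour_eq hf
  have key : ∀ {P : Fin n × Fin n → Prop} [DecidablePred P] (g : Fin n × Fin n → Fin n),
      (∀ a a', P a → P a' → g a = g a' → a = a') → (Finset.univ.filter P).card ≤ n :=
    fun {_} _ g h => (card_filter_le_of_injOn g h).trans_eq (Fintype.card_fin n)
  have hloops : (Finset.univ.filter fun p : Fin n × Fin n => f p.1 = p.1).card =
      loopCount φ c * n := by
    have h1 : (Finset.univ.filter fun p : Fin n × Fin n => f p.1 = p.1) =
        (Finset.univ.filter fun w => φ w w = c) ×ˢ Finset.univ := by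
      ext ⟨a, b⟩
      simp only [Finset.mem_filter, Finset.mem_univ, true_and, Finset.mem_product, and_true]
      exact ⟨fun h => by simpa [h] using hf a, fun h => hφ.1 a _ _ ((hf a).trans h.symm)⟩
    rw [h1, Finset.card_product, loopCount, Nat.card_eq_fintype_card, Fintype.card_subtype]
    simp
  have hbad := card_filter_or_le_add hloops.le <|
    card_filter_or_le_add (key (P := fun p => p.1 = u) Prod.snd ?_) <|
    card_filter_or_le_add (key (P := fun p => p.1 = v) Prod.snd ?_) <|
    card_filter_or_le_add (key (P := fun p => f p.1 = u) Prod.snd ?_) <|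
    card_filter_or_le_add (key (P := fun p => f p.1 = v) Prod.snd ?_) <|
    card_filter_or_le_add (key (P := fun p => p.2 = p.1) Prod.fst ?_) <|
    card_filter_or_le_add (key (P := fun p => p.2 = f p.1) Prod.fst ?_) <|
    card_filter_or_le_add (key (P := fun p => p.2 = u) Prod.fst ?_) <|
    card_filter_or_le_add (key (P := fun p => p.2 = v) Prod.fst ?_) <|
    card_filter_or_le_add (key (P := fun p => φ u p.1 = c) Prod.snd ?_) <|
    card_filter_or_le_add (key (P := fun p => φ (f p.1) p.2 = c) Prod.fst ?_) <|
    card_filter_or_le_add (key (P := fun p => φ (f p.1) p.2 = φ u p.1) Prod.fst ?_) <|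
    card_filter_or_le_add (key (P := fun p => φ p.2 v = c) Prod.fst ?_) <|
    card_filter_or_le_add (key (P := fun p => φ p.2 v = φ u p.1) Prod.fst ?_)
      (key (P := fun p => φ (f p.1) p.2 = φ p.2 v) Prod.snd ?_)
  · have hle : (Finset.univ \ rainbowPairs φ f u v).card ≤
        loopCount φ c * n + 14 * n := by
      refine (Finset.card_le_card fun p hp => Finset.mem_filter.2 ⟨Finset.mem_univ p, ?_⟩).trans
        (hbad.trans_eq (by ring))
      by_contra hgood
      refine (Finset.mem_sdiff.1 hp).2 (Finset.mem_filter.2 ⟨Finset.mem_univ p, ?_⟩)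
      simp only [not_or] at hgood
      obtain ⟨h1, h2, h3, h4, h5, h6, h7, h8, h9, h10, h11, h12, h13, h14, h15⟩ := hgood
      simp [hf, huv, Ne.symm h1, Ne.symm h2, h3, Ne.symm h4, h5, Ne.symm h6, Ne.symm h7,
        Ne.symm h8, h9, h10, Ne.symm h11, Ne.symm h12, Ne.symm h13, Ne.symm h14, h15]
    rw [Finset.card_sdiff_of_subset (Finset.subset_univ _)] at hle
    simp only [Finset.card_univ, Fintype.card_prod, Fintype.card_fin] at hle
    have := Nat.mul_le_mul_right n hloop
    rw [mul_assoc] at this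
    omega
  all_goals
    rintro ⟨a, b⟩ ⟨a', b'⟩ h1 h2 h3
    simp only at h1 h2 h3
    subst h3
  · rw [h1, h2]
  · rw [h1, h2]
  · rw [hinj (h1.trans h2.symm)]
  · rw [hinj (h1.trans h2.symm)]
  · rw [h1, h2]
  · rw [h1, h2]
  · rw [h1, h2]
  · rw [h1, h2]
  · rw [hφ.1 _ _ _ (h1.trans h2.symm)]
  · rw [hφ.1 _ _ _ (h1.trans h2.symm)]
  · rw [hφ.1 _ _ _ (h1.trans h2.symm)]
  · rw [hφ.2 _ _ _ (h1.trans h2.symm)]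
  · rw [hφ.2 _ _ _ (h1.trans h2.symm)]
  · rw [hinj (hφ.2 _ _ _ (h1.trans h2.symm))]

/-- If no colour of `G` has more than `n/2` loops, then with
`m = ⌊n/log³ n⌋` there are sets `V'`, `C'` of size `2m` such that every pair of distinct
vertices `u, v` and every colour `c` admit at least `n^{99/50}` rainbow directed
length-four paths from `u` to `v` whose second arc has colour `c`, with internal vertices
in `V'` and all other colours in `C'`. -/
theorem statement_19 :
    ∃ n₀ : ℕ, ∀ n : ℕ, n₀ ≤ n → ∀ G : Colouring n,
      (∀ c : Fin n, (loopCount G.1 c : ℝ) ≤ n / 2) →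
      ∃ V' C' : Finset (Fin n),
        V'.card = 2 * ⌊(n : ℝ) / Real.log n ^ 3⌋₊ ∧
        C'.card = 2 * ⌊(n : ℝ) / Real.log n ^ 3⌋₊ ∧
        ∀ u v : Fin n, u ≠ v → ∀ c : Fin n,
          (n : ℝ) ^ (99 / 50 : ℝ) ≤
            (Nat.card {p : Fin n × Fin n × Fin n //
              ([u, p.1, p.2.1, p.2.2, v] : List (Fin n)).Nodup ∧
              G.1 p.1 p.2.1 = c ∧
              ([G.1 u p.1, G.1 p.1 p.2.1, G.1 p.2.1 p.2.2, G.1 p.2.2 v] :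
                List (Fin n)).Nodup ∧
              p.1 ∈ V' ∧ p.2.1 ∈ V' ∧ p.2.2 ∈ V' ∧
              (∀ d ∈ ([G.1 u p.1, G.1 p.1 p.2.1, G.1 p.2.1 p.2.2, G.1 p.2.2 v] :
                  List (Fin n)), d ≠ c → d ∈ C')} : ℝ) := by
  obtain ⟨n₀, hn₀⟩ := Filter.eventually_atTop.1 eventually_exists_parameters
  refine ⟨n₀, fun n hn G hG => ?_⟩
  obtain ⟨q, T, r, hq, hr, hcount, hlt, hqm, hmn⟩ := hn₀ n hn
  obtain ⟨φ, hφ⟩ := G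
  have hsurj : ∀ c w : Fin n, ∃ w', φ w w' = c := fun c w =>
    (Finite.injective_iff_surjective.1 fun a b h => hφ.1 w a b h) c
  choose f hf using hsurj
  have hloop : ∀ c, 2 * loopCount φ c ≤ n := fun c => by
    have h : (loopCount φ c : ℝ) ≤ n / 2 := hG c
    have : (2 * loopCount φ c : ℝ) ≤ n := by linarith
    exact_mod_cast this
  have hκ : Fintype.card {t : Fin n × Fin n × Fin n // t.1 ≠ t.2.1} ≤ n * n * n :=
    (Fintype.card_subtype_le _).trans_eq (by simp [mul_assoc])
  obtain ⟨S, hS, hSr⟩ := exists_small_set_inducing_many_edges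
    (κ := {t : Fin n × Fin n × Fin n // t.1 ≠ t.2.1}) (s := 6) (D := 6 * n) (T := T) (r := r) hq
    (fun t => pathSupport φ (f t.1.2.2) t.1.1 t.1.2.1)
    (fun t => rainbowPairs φ (f t.1.2.2) t.1.1 t.1.2.1)
    (fun _ _ _ => pathSupport_nonempty ..)
    (fun _ _ _ => card_pathSupport_le ..)
    (fun t x => (Finset.card_le_card (Finset.filter_subset_filter _ (Finset.subset_univ _))).trans
      (hφ.card_filter_mem_pathSupport_le (hφ.injective_of_colour_eq (hf _)) _ _ x))
    (fun t => by
      have := hφ.mul_self_le_card_rainbowPairs (hf t.1.2.2) (hloop _) t.2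
      omega)
    (lt_of_le_of_lt (by gcongr) hlt)
  set m := ⌊(n : ℝ) / Real.log n ^ 3⌋₊
  have hS2 : S.card ≤ 2 * m := by
    refine Nat.le_of_mul_le_mul_left (hS.trans ?_) hq
    rw [Fintype.card_sum, Fintype.card_fin]
    linarith
  obtain ⟨V', hV, hVcard⟩ := Finset.exists_superset_card_eq
    (Finset.card_toLeft_le.trans hS2) (by simpa using hmn)
  obtain ⟨C', hC, hCcard⟩ := Finset.exists_superset_card_eq
    (Finset.card_toRight_le.trans hS2) (by simpa using hmn)
  refine ⟨V', C', hVcard, hCcard, fun u v huv c => hr.trans ?_⟩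
  have hle := hSr ⟨(u, v, c), huv⟩
  rw [Nat.card_eq_fintype_card, Fintype.card_subtype]
  refine Nat.cast_le.2 (hle.trans ?_)
  refine Finset.card_le_card_of_injOn (fun p => (p.1, f c p.1, p.2)) ?_ ?_
  · intro p hp
    simp only [Finset.coe_filter, Set.mem_ofPred_eq, rainbowPairs, Finset.mem_filter,
      Finset.mem_univ, true_and] at hp
    obtain ⟨⟨hnd, hrb⟩, hsupp⟩ := hp
    have hVmem : ∀ w, .inl w ∈ pathSupport φ (f c) u v p → w ∈ V' := fun w hw =>
      hV (Finset.mem_toLeft.2 (hsupp hw))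
    have hCmem : ∀ d, .inr d ∈ pathSupport φ (f c) u v p → d ∈ C' := fun d hd =>
      hC (Finset.mem_toRight.2 (hsupp hd))
    simp only [Finset.coe_filter, Set.mem_ofPred_eq, Finset.mem_univ, true_and]
    refine ⟨hnd, hf c _, hrb, hVmem _ ?_, hVmem _ ?_, hVmem _ ?_, fun d hd hdc => hCmem d ?_⟩
    · simp [pathSupport]
    · simp [pathSupport]
    · simp [pathSupport]
    · simp only [List.mem_cons, List.not_mem_nil, or_false, hf, hdc, false_or] at hd
      simpa [pathSupport] using hd
  · rintro ⟨a, b⟩ _ ⟨a', b'⟩ _ h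
    simp only [Prod.mk.injEq] at h
    exact Prod.ext h.1 h.2.2

end RandomLatin
end
end
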